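/- arXiv:1109.4093 — 12 statements merged into one kernel-verified Lean document; each statement's English description precedes it below -/
import Mathlib

section
/- The standard system is an (m,n)-dynamical system; precisely: (i) Y^u is a clopen subset of Ω^u; (ii) the sets H_i^u := Ω^u_{a_i} (i = 1,…,n) are pairwise disjoint clopen subsets of Ω^u whose union is X^u; (iii) the sets V_j^u := Ω^u_{b_j} (j = 1,…,m) are pairwise disjoint clopen subsets of Ω^u whose union is X^u; (iv) for each i the map h_i^u : ξ ↦ a_iξ is a homeomorphism from Y^u onto H_i^u, and for each j the map v_j^u : ξ ↦ b_jξ is a homeomorphism from Y^u onto V_j^u. -/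
/-- The free group on `m + n` generators `a_1, …, a_n, b_1, …, b_m`. -/
abbrev F (n m : ℕ) : Type := FreeGroup (Fin n ⊕ Fin m)

/-- The generator `a_i`. -/
def a {n m : ℕ} (i : Fin n) : F n m := FreeGroup.of (Sum.inl i)

/-- The generator `b_j`. -/
def b {n m : ℕ} (j : Fin m) : F n m := FreeGroup.of (Sum.inr j)

/-- The translate `g ξ = {g h : h ∈ ξ}`, for subsets of `F n m` encoded as
boolean-valued functions: `(g ξ)(k) = ξ(g⁻¹ k)`. -/
def transl {n m : ℕ} (g : F n m) (ξ : F n m → Bool) : F n m → Bool :=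
  fun k => ξ (g⁻¹ * k)

/-- `ξ` is convex. -/
def IsConvexCfg {n m : ℕ} (ξ : F n m → Bool) : Prop :=
  ∀ g h k : F n m, ξ g = true → ξ h = true →
    (g⁻¹ * k).norm + (k⁻¹ * h).norm = (g⁻¹ * h).norm → ξ k = true

/-- `ξ` has pattern (c1) at `g`. -/
def PatternC1 {n m : ℕ} (ξ : F n m → Bool) (g : F n m) : Prop :=
  (∃! i : Fin n, ξ (g * a i) = true) ∧ (∃! j : Fin m, ξ (g * b j) = true) ∧
  (∀ i : Fin n, ξ (g * (a i)⁻¹) = false) ∧ (∀ j : Fin m, ξ (g * (b j)⁻¹) = false)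

/-- `ξ` has pattern (c2) at `g`. -/
def PatternC2 {n m : ℕ} (ξ : F n m → Bool) (g : F n m) : Prop :=
  (∀ i : Fin n, ξ (g * a i) = false) ∧ (∀ j : Fin m, ξ (g * b j) = false) ∧
  (∀ i : Fin n, ξ (g * (a i)⁻¹) = true) ∧ (∀ j : Fin m, ξ (g * (b j)⁻¹) = true)

/-- The universal configuration space `Ω^u`, as a subset of the product space
`{0,1}^F` (encoded as `F n m → Bool` with the product topology). -/
def Omega (n m : ℕ) : Set (F n m → Bool) :=
  {ξ | ξ 1 = true ∧ IsConvexCfg ξ ∧ ∀ g : F n m, ξ g = true → (PatternC1 ξ g ∨ PatternC2 ξ g)}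

/-- `Y^u`: the configurations with pattern (c2) at `1`. -/
def Yu (n m : ℕ) : Set (F n m → Bool) :=
  {ξ | ξ ∈ Omega n m ∧ (∀ i : Fin n, ξ (a i)⁻¹ = true) ∧ (∀ j : Fin m, ξ (b j)⁻¹ = true)}

/-- `X^u = Ω^u \ Y^u`. -/
def Xu (n m : ℕ) : Set (F n m → Bool) := Omega n m \ Yu n m

/-- `H_i^u = Ω^u_{a_i}`. -/
def Hu (n m : ℕ) (i : Fin n) : Set (F n m → Bool) :=
  {ξ | ξ ∈ Omega n m ∧ ξ (a i) = true}

/-- `V_j^u = Ω^u_{b_j}`. -/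
def Vu (n m : ℕ) (j : Fin m) : Set (F n m → Bool) :=
  {ξ | ξ ∈ Omega n m ∧ ξ (b j) = true}

theorem transl_transl {n m : ℕ} (g h : F n m) (ξ : F n m → Bool) :
    transl g (transl h ξ) = transl (g * h) ξ := by
  funext k
  simp [transl, mul_assoc]

theorem transl_one {n m : ℕ} (ξ : F n m → Bool) : transl 1 ξ = ξ := by
  funext k
  simp [transl]

theorem continuous_transl {n m : ℕ} (g : F n m) :
    Continuous (transl g : (F n m → Bool) → F n m → Bool) :=
  continuous_pi fun k => continuous_apply (g⁻¹ * k)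

/-- Translation by `g` as a homeomorphism between two sets of configurations that are
exchanged by `transl g` and `transl g⁻¹`. -/
def translHomeomorph {n m : ℕ} (g : F n m) (A B : Set (F n m → Bool))
    (hA : ∀ ξ ∈ A, transl g ξ ∈ B) (hB : ∀ ξ ∈ B, transl g⁻¹ ξ ∈ A) : A ≃ₜ B where
  toFun ξ := ⟨transl g ξ, hA ξ ξ.2⟩
  invFun ξ := ⟨transl g⁻¹ ξ, hB ξ ξ.2⟩
  left_inv ξ := Subtype.ext (by simp [transl_transl, transl_one])
  right_inv ξ := Subtype.ext (by simp [transl_transl, transl_one])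
  continuous_toFun := ((continuous_transl g).comp continuous_subtype_val).subtype_mk _
  continuous_invFun := ((continuous_transl g⁻¹).comp continuous_subtype_val).subtype_mk _

theorem IsConvexCfg.transl {n m : ℕ} {ξ : F n m → Bool} (hξ : IsConvexCfg ξ) (g : F n m) :
    IsConvexCfg (transl g ξ) := by
  intro x y k hx hy hk
  refine hξ (g⁻¹ * x) (g⁻¹ * y) (g⁻¹ * k) hx hy ?_
  simpa [mul_assoc] using hk

theorem patternC1_transl {n m : ℕ} (g k : F n m) (ξ : F n m → Bool) :
    PatternC1 (transl g ξ) k ↔ PatternC1 ξ (g⁻¹ * k) := by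
  simp only [PatternC1, transl, mul_assoc]

theorem patternC2_transl {n m : ℕ} (g k : F n m) (ξ : F n m → Bool) :
    PatternC2 (transl g ξ) k ↔ PatternC2 ξ (g⁻¹ * k) := by
  simp only [PatternC2, transl, mul_assoc]

theorem transl_mem_Omega {n m : ℕ} {ξ : F n m → Bool} (hξ : ξ ∈ Omega n m) {g : F n m}
    (hg : ξ g⁻¹ = true) : transl g ξ ∈ Omega n m := by
  refine ⟨by simpa [transl] using hg, hξ.2.1.transl g, fun k hk => ?_⟩
  rw [patternC1_transl, patternC2_transl]
  exact hξ.2.2 _ hk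

theorem mem_Yu_iff_patternC2 {n m : ℕ} (hn : 0 < n) {ξ : F n m → Bool} (hξ : ξ ∈ Omega n m) :
    ξ ∈ Yu n m ↔ PatternC2 ξ 1 := by
  constructor
  · rintro ⟨-, hA, -⟩
    refine (hξ.2.2 1 hξ.1).resolve_left fun h => ?_
    have := h.2.2.1 ⟨0, hn⟩
    rw [one_mul, hA] at this
    exact absurd this (by simp)
  · rintro ⟨-, -, hA, hB⟩
    simp only [one_mul] at hA hB
    exact ⟨hξ, hA, hB⟩

theorem mem_Xu_iff_patternC1 {n m : ℕ} (hn : 0 < n) {ξ : F n m → Bool} (hξ : ξ ∈ Omega n m) :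
    ξ ∈ Xu n m ↔ PatternC1 ξ 1 := by
  have hX : ξ ∈ Xu n m ↔ ¬ PatternC2 ξ 1 := by
    rw [← mem_Yu_iff_patternC2 hn hξ]
    exact ⟨fun h => h.2, fun h => ⟨hξ, h⟩⟩
  rw [hX]
  refine ⟨(hξ.2.2 1 hξ.1).resolve_right, fun h h' => ?_⟩
  have := h.2.2.1 ⟨0, hn⟩
  rw [h'.2.2.1] at this
  exact absurd this (by simp)

theorem patternC1_of_apply_a {n m : ℕ} {ξ : F n m → Bool} (hξ : ξ ∈ Omega n m) {i : Fin n}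
    (hi : ξ (a i) = true) : PatternC1 ξ 1 := by
  refine (hξ.2.2 1 hξ.1).resolve_right fun h => ?_
  have := h.1 i
  rw [one_mul, hi] at this
  exact absurd this (by simp)

theorem patternC1_of_apply_b {n m : ℕ} {ξ : F n m → Bool} (hξ : ξ ∈ Omega n m) {j : Fin m}
    (hj : ξ (b j) = true) : PatternC1 ξ 1 := by
  refine (hξ.2.2 1 hξ.1).resolve_right fun h => ?_
  have := h.2.1 j
  rw [one_mul, hj] at this
  exact absurd this (by simp)

theorem transl_inv_a_mem_Yu {n m : ℕ} (hn : 0 < n) {i : Fin n} {ξ : F n m → Bool}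
    (hξ : ξ ∈ Hu n m i) : transl (a i)⁻¹ ξ ∈ Yu n m := by
  have hΩ := transl_mem_Omega hξ.1 (g := (a i)⁻¹) (by simpa using hξ.2)
  rw [mem_Yu_iff_patternC2 hn hΩ, patternC2_transl]
  simp only [inv_inv, mul_one]
  refine (hξ.1.2.2 _ hξ.2).resolve_left fun h => ?_
  have := h.2.2.1 i
  rw [mul_inv_cancel, hξ.1.1] at this
  exact absurd this (by simp)

theorem transl_inv_b_mem_Yu {n m : ℕ} (hn : 0 < n) {j : Fin m} {ξ : F n m → Bool}
    (hξ : ξ ∈ Vu n m j) : transl (b j)⁻¹ ξ ∈ Yu n m := by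
  have hΩ := transl_mem_Omega hξ.1 (g := (b j)⁻¹) (by simpa using hξ.2)
  rw [mem_Yu_iff_patternC2 hn hΩ, patternC2_transl]
  simp only [inv_inv, mul_one]
  refine (hξ.1.2.2 _ hξ.2).resolve_left fun h => ?_
  have := h.2.2.2 j
  rw [mul_inv_cancel, hξ.1.1] at this
  exact absurd this (by simp)

theorem isClopen_apply_eq_true {n m : ℕ} (g : F n m) :
    IsClopen {ξ : ↥(Omega n m) | (ξ : F n m → Bool) g = true} :=
  (isClopen_discrete {true}).preimage ((continuous_apply g).comp continuous_subtype_val)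

theorem isClopen_Yu (n m : ℕ) :
    IsClopen {ξ : ↥(Omega n m) | (ξ : F n m → Bool) ∈ Yu n m} := by
  have h : {ξ : ↥(Omega n m) | (ξ : F n m → Bool) ∈ Yu n m} =
      (⋂ i : Fin n, {ξ : ↥(Omega n m) | (ξ : F n m → Bool) (a i)⁻¹ = true}) ∩
        ⋂ j : Fin m, {ξ : ↥(Omega n m) | (ξ : F n m → Bool) (b j)⁻¹ = true} := by
    ext ξ
    simp [Yu]
  rw [h]
  exact (isClopen_iInter_of_finite fun _ => isClopen_apply_eq_true _).inter
    (isClopen_iInter_of_finite fun _ => isClopen_apply_eq_true _)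

theorem isClopen_Hu {n m : ℕ} (i : Fin n) :
    IsClopen {ξ : ↥(Omega n m) | (ξ : F n m → Bool) ∈ Hu n m i} := by
  simpa [Hu] using isClopen_apply_eq_true (a i : F n m)

theorem isClopen_Vu {n m : ℕ} (j : Fin m) :
    IsClopen {ξ : ↥(Omega n m) | (ξ : F n m → Bool) ∈ Vu n m j} := by
  simpa [Vu] using isClopen_apply_eq_true (b j : F n m)

theorem Hu_inter_eq_empty {n m : ℕ} {i i' : Fin n} (h : i ≠ i') :
    Hu n m i ∩ Hu n m i' = ∅ := by
  rw [Set.eq_empty_iff_forall_notMem]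
  rintro ξ ⟨⟨hξ, hi⟩, -, hi'⟩
  exact h ((patternC1_of_apply_a hξ hi).1.unique (by simpa using hi) (by simpa using hi'))

theorem Vu_inter_eq_empty {n m : ℕ} {j j' : Fin m} (h : j ≠ j') :
    Vu n m j ∩ Vu n m j' = ∅ := by
  rw [Set.eq_empty_iff_forall_notMem]
  rintro ξ ⟨⟨hξ, hj⟩, -, hj'⟩
  exact h ((patternC1_of_apply_b hξ hj).2.1.unique (by simpa using hj) (by simpa using hj'))

theorem iUnion_Hu {n m : ℕ} (hn : 0 < n) : (⋃ i : Fin n, Hu n m i) = Xu n m := by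
  ext ξ
  rw [Set.mem_iUnion]
  constructor
  · rintro ⟨i, hξ, hi⟩
    exact (mem_Xu_iff_patternC1 hn hξ).2 (patternC1_of_apply_a hξ hi)
  · intro h
    obtain ⟨i, hi, -⟩ := ((mem_Xu_iff_patternC1 hn h.1).1 h).1
    exact ⟨i, h.1, by simpa using hi⟩

theorem iUnion_Vu {n m : ℕ} (hn : 0 < n) : (⋃ j : Fin m, Vu n m j) = Xu n m := by
  ext ξ
  rw [Set.mem_iUnion]
  constructor
  · rintro ⟨j, hξ, hj⟩
    exact (mem_Xu_iff_patternC1 hn hξ).2 (patternC1_of_apply_b hξ hj)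
  · intro h
    obtain ⟨j, hj, -⟩ := ((mem_Xu_iff_patternC1 hn h.1).1 h).2.1
    exact ⟨j, h.1, by simpa using hj⟩

/-- the standard system is an `(m,n)`-dynamical system:
(i) `Y^u` is clopen in `Ω^u`;
(ii) the `H_i^u` are pairwise disjoint clopen subsets of `Ω^u` with union `X^u`;
(iii) the `V_j^u` are pairwise disjoint clopen subsets of `Ω^u` with union `X^u`;
(iv) `h_i^u : ξ ↦ a_iξ` is a homeomorphism from `Y^u` onto `H_i^u` and
`v_j^u : ξ ↦ b_jξ` is a homeomorphism from `Y^u` onto `V_j^u`. -/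
theorem stmt_2 (n m : ℕ) (hn : 0 < n) (hm : 0 < m) :
    IsClopen {ξ : ↥(Omega n m) | (ξ : F n m → Bool) ∈ Yu n m} ∧
    (∀ i : Fin n, IsClopen {ξ : ↥(Omega n m) | (ξ : F n m → Bool) ∈ Hu n m i}) ∧
    (∀ i i' : Fin n, i ≠ i' → Hu n m i ∩ Hu n m i' = ∅) ∧
    (⋃ i : Fin n, Hu n m i) = Xu n m ∧
    (∀ j : Fin m, IsClopen {ξ : ↥(Omega n m) | (ξ : F n m → Bool) ∈ Vu n m j}) ∧
    (∀ j j' : Fin m, j ≠ j' → Vu n m j ∩ Vu n m j' = ∅) ∧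
    (⋃ j : Fin m, Vu n m j) = Xu n m ∧
    (∀ i : Fin n, ∃ h : ↥(Yu n m) ≃ₜ ↥(Hu n m i),
      ∀ ξ, (h ξ : F n m → Bool) = transl (a i) (ξ : F n m → Bool)) ∧
    (∀ j : Fin m, ∃ h : ↥(Yu n m) ≃ₜ ↥(Vu n m j),
      ∀ ξ, (h ξ : F n m → Bool) = transl (b j) (ξ : F n m → Bool)) := by
  refine ⟨isClopen_Yu n m, isClopen_Hu, fun _ _ => Hu_inter_eq_empty, iUnion_Hu hn,
    isClopen_Vu, fun _ _ => Vu_inter_eq_empty, iUnion_Vu hn, fun i => ?_, fun j => ?_⟩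
  · exact ⟨translHomeomorph (a i) _ _
      (fun ξ hξ => ⟨transl_mem_Omega hξ.1 (hξ.2.1 i), by simpa [transl] using hξ.1.1⟩)
      (fun ξ hξ => transl_inv_a_mem_Yu hn hξ), fun _ => rfl⟩
  · exact ⟨translHomeomorph (b j) _ _
      (fun ξ hξ => ⟨transl_mem_Omega hξ.1 (hξ.2.2 j), by simpa [transl] using hξ.1.1⟩)
      (fun ξ hξ => transl_inv_b_mem_Yu hn hξ), fun _ => rfl⟩
end

section
/- The standard (m,n)-dynamical system is universal: let X and Y be compact Hausdorff spaces, let H_1,…,H_n be pairwise disjoint clopen subsets of X with X = H_1 ∪ ⋯ ∪ H_n, let V_1,…,V_m be pairwise disjoint clopen subsets of X with X = V_1 ∪ ⋯ ∪ V_m, and let h_i : Y → X (i = 1,…,n) and v_j : Y → X (j = 1,…,m) be continuous maps that are homeomorphisms of Y onto H_i and onto V_j respectively. Then there exists a unique continuous map γ from the topological disjoint union X ⊔ Y to Ω^u such that: (i) γ(Y) ⊆ Y^u; (ii) γ(X) ⊆ X^u; (iii) γ(h_i(y)) = a_i·γ(y) for all y ∈ Y and all i; (iv) γ(v_j(y))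 = b_j·γ(y) for all y ∈ Y and all j (where g·ξ denotes the translate gξ = {g·h : h ∈ ξ}). -/
namespace FreeGroup

variable {α : Type*} [DecidableEq α]

/-- If the norms of `x` and `y` add up, then there is no cancellation in the product `x * y`. -/
theorem toWord_append_of_norm_add {x y : FreeGroup α} (hxy : x.norm + y.norm = (x * y).norm) :
    (x * y).toWord = x.toWord ++ y.toWord :=
  (toWord_mul_sublist x y).eq_of_length (by simpa [norm] using hxy.symm)

end FreeGroup

section PartialAction

variable {α X Y : Type*}

/-- The partial bijections of `X ⊕ Y` attached to the letters `t⁻¹` (sending `f t y` to `y`, encoded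
by `(t, true)`) and `t` (sending `y` to `f t y`, encoded by `(t, false)`). -/
noncomputable def letterStep (f : α → Y → X) : α × Bool → X ⊕ Y → Option (X ⊕ Y)
  | (t, true), .inl x => (Function.partialInv (f t) x).map .inr
  | (_, true), .inr _ => none
  | (_, false), .inl _ => none
  | (t, false), .inr y => some (.inl (f t y))

/-- Follow the letters of a word one after the other. -/
noncomputable def walk (f : α → Y → X) : List (α × Bool) → X ⊕ Y → Option (X ⊕ Y)
  | [], z => some z
  | s :: L, z => (letterStep f s z).bind (walk f L)

/-- Follow the reduced word of a group element. -/
noncomputable def groupWalk [DecidableEq α] (f : α → Y → X) (g : FreeGroup α) (z : X ⊕ Y) :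
    Option (X ⊕ Y) :=
  walk f g.toWord z

/-- The configuration of a point: the group elements whose walk from the point is defined. -/
noncomputable def config [DecidableEq α] (f : α → Y → X) (z : X ⊕ Y) (g : FreeGroup α) : Bool :=
  (groupWalk f g z).isSome

variable {f : α → Y → X}

theorem letterStep_true_inl_eq_some (hf : ∀ t, (f t).Injective) {t : α} {x : X} {w : X ⊕ Y} :
    letterStep f (t, true) (.inl x) = some w ↔ ∃ y, f t y = x ∧ .inr y = w := by
  simp [letterStep, (hf t).isPartialInv _ _]

theorem letterStep_isSome (hf : ∀ t, (f t).Injective) {t : α} {x : X} :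
    (letterStep f (t, true) (.inl x)).isSome ↔ x ∈ Set.range (f t) := by
  simp [Option.isSome_iff_exists, letterStep_true_inl_eq_some hf]

theorem letterStep_inv (hf : ∀ t, (f t).Injective) {t : α} {c : Bool} {z w : X ⊕ Y}
    (hzw : letterStep f (t, c) z = some w) : letterStep f (t, !c) w = some z := by
  cases c <;> rcases z with x | y
  · simp [letterStep] at hzw
  · obtain rfl : .inl (f t y) = w := by simpa [letterStep] using hzw
    exact (letterStep_true_inl_eq_some hf).2 ⟨y, rfl, rfl⟩
  · obtain ⟨y, rfl, rfl⟩ := (letterStep_true_inl_eq_some hf).1 hzw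
    rfl
  · simp [letterStep] at hzw

theorem walk_append (L₁ L₂ : List (α × Bool)) (z : X ⊕ Y) :
    walk f (L₁ ++ L₂) z = (walk f L₁ z).bind (walk f L₂) := by
  induction L₁ generalizing z with
  | nil => rfl
  | cons s L ih =>
    simp only [List.cons_append, walk]
    cases letterStep f s z <;> simp [ih]

theorem walk_of_red (hf : ∀ t, (f t).Injective) {L₁ L₂ : List (α × Bool)} {z w : X ⊕ Y}
    (hL : FreeGroup.Red L₁ L₂) (hw : walk f L₁ z = some w) : walk f L₂ z = some w := by
  induction hL with
  | refl => exact hw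
  | tail _ hs ih =>
    cases hs with
    | @not L L' t c =>
      simp only [walk_append, walk, Option.bind_eq_some_iff] at ih ⊢
      obtain ⟨p, hp, q, hq, r, hr, hrw⟩ := ih
      obtain rfl : p = r := by simpa [letterStep_inv hf hq] using hr
      exact ⟨p, hp, hrw⟩

theorem walk_invRev (hf : ∀ t, (f t).Injective) {L : List (α × Bool)} {z w : X ⊕ Y}
    (hw : walk f L z = some w) : walk f (FreeGroup.invRev L) w = some z := by
  induction L generalizing z with
  | nil => simpa [walk, eq_comm] using hw
  | cons s L ih =>
    obtain ⟨p, hp, hpw⟩ := Option.bind_eq_some_iff.1 hw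
    have := ih hpw
    simp only [FreeGroup.invRev, List.map_cons, List.reverse_cons] at this ⊢
    simp [walk_append, this, walk, letterStep_inv hf hp]

theorem isClopen_letterStep [TopologicalSpace X] [TopologicalSpace Y]
    (hf : ∀ t, (f t).Injective) (hc : ∀ t, Continuous (f t))
    (hclopen : ∀ t (D : Set Y), IsClopen D → IsClopen (f t '' D)) (s : α × Bool)
    {D : Set (X ⊕ Y)} (hD : IsClopen D) :
    IsClopen {z | ∃ w ∈ D, letterStep f s z = some w} := by
  obtain ⟨t, c⟩ := s
  have key (E : Set (X ⊕ Y)) (h₁ : IsClopen (Sum.inl ⁻¹' E)) (h₂ : IsClopen (Sum.inr ⁻¹' E)) :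
      IsClopen E :=
    ⟨isClosed_sum_iff.2 ⟨h₁.1, h₂.1⟩, isOpen_sum_iff.2 ⟨h₁.2, h₂.2⟩⟩
  apply key <;> cases c
  · simp [letterStep, isClopen_empty]
  · convert hclopen t _ (hD.preimage continuous_inr) using 1
    ext x
    simp only [Set.mem_preimage, Set.mem_ofPred_eq, letterStep_true_inl_eq_some hf, Set.mem_image]
    grind
  · convert hD.preimage (continuous_inl.comp (hc t)) using 1
    ext y
    simp [letterStep]
  · simp [letterStep, isClopen_empty]

theorem isClopen_walk_isSome [TopologicalSpace X] [TopologicalSpace Y]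
    (hf : ∀ t, (f t).Injective) (hc : ∀ t, Continuous (f t))
    (hclopen : ∀ t (D : Set Y), IsClopen D → IsClopen (f t '' D)) (L : List (α × Bool)) :
    IsClopen {z | (walk f L z).isSome} := by
  induction L with
  | nil => simp [walk, isClopen_univ]
  | cons s L ih =>
    convert isClopen_letterStep hf hc hclopen s ih using 1
    ext z
    simp only [walk, Set.mem_ofPred_eq]
    cases letterStep f s z <;> simp

variable [DecidableEq α]

theorem groupWalk_inv (hf : ∀ t, (f t).Injective) {g : FreeGroup α} {z w : X ⊕ Y}
    (hw : groupWalk f g z = some w) : groupWalk f g⁻¹ w = some z := by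
  simpa [groupWalk, FreeGroup.toWord_inv] using walk_invRev hf hw

theorem groupWalk_mul_of_eq_some (hf : ∀ t, (f t).Injective) {g k : FreeGroup α} {z w u : X ⊕ Y}
    (hw : groupWalk f g z = some w) (hu : groupWalk f k w = some u) :
    groupWalk f (g * k) z = some u := by
  rw [groupWalk, FreeGroup.toWord_mul]
  refine walk_of_red hf FreeGroup.reduce.red ?_
  simp only [groupWalk] at hw hu
  simp [walk_append, hw, hu]

theorem groupWalk_mul (hf : ∀ t, (f t).Injective) {g : FreeGroup α} {z w : X ⊕ Y}
    (hw : groupWalk f g z = some w) (k : FreeGroup α) :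
    groupWalk f (g * k) z = groupWalk f k w := by
  refine Option.ext fun u => ⟨fun hu => ?_, groupWalk_mul_of_eq_some hf hw⟩
  simpa using groupWalk_mul_of_eq_some hf (groupWalk_inv hf hw) hu

theorem config_mul (hf : ∀ t, (f t).Injective) {g : FreeGroup α} {z w : X ⊕ Y}
    (hw : groupWalk f g z = some w) (k : FreeGroup α) : config f z (g * k) = config f w k := by
  rw [config, groupWalk_mul hf hw, config]

theorem config_one (z : X ⊕ Y) : config f z 1 = true := by
  simp [config, groupWalk, walk]

theorem groupWalk_of (t : α) (z : X ⊕ Y) :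
    groupWalk f (.of t) z = letterStep f (t, true) z := by
  simp [groupWalk, walk]

theorem groupWalk_of_inv (t : α) (z : X ⊕ Y) :
    groupWalk f (.of t)⁻¹ z = letterStep f (t, false) z := by
  simp [groupWalk, FreeGroup.toWord_inv, FreeGroup.invRev, walk]

theorem config_inl_of (hf : ∀ t, (f t).Injective) (x : X) (t : α) :
    config f (.inl x) (.of t) = true ↔ x ∈ Set.range (f t) := by
  rw [config, groupWalk_of, letterStep_isSome hf]

theorem config_inl_of_inv (x : X) (t : α) : config f (.inl x) (.of t)⁻¹ = false := by
  rw [config, groupWalk_of_inv]; rfl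

theorem config_inr_of (y : Y) (t : α) : config f (.inr y) (.of t) = false := by
  rw [config, groupWalk_of]; rfl

theorem config_inr_of_inv (y : Y) (t : α) : config f (.inr y) (.of t)⁻¹ = true := by
  rw [config, groupWalk_of_inv]; rfl

theorem config_equivariant (hf : ∀ t, (f t).Injective) (t : α) (y : Y) (k : FreeGroup α) :
    config f (.inl (f t y)) k = config f (.inr y) ((.of t)⁻¹ * k) :=
  (config_mul hf (groupWalk_of_inv t (.inr y)) k).symm

theorem continuous_config [TopologicalSpace X] [TopologicalSpace Y]
    (hf : ∀ t, (f t).Injective) (hc : ∀ t, Continuous (f t))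
    (hclopen : ∀ t (D : Set Y), IsClopen D → IsClopen (f t '' D)) :
    Continuous (config f) :=
  continuous_pi fun g => (continuous_bool_rng true).2 <| by
    convert isClopen_walk_isSome hf hc hclopen g.toWord using 1
    rfl

end PartialAction

section Configurations

variable {n m : ℕ} {X Y : Type*} {h : Fin n → Y → X} {v : Fin m → Y → X}

theorem isConvexCfg_config {f : Fin n ⊕ Fin m → Y → X} (hf : ∀ t, (f t).Injective) (z : X ⊕ Y) :
    IsConvexCfg (config f z) := by
  intro g k l hg hk hl
  obtain ⟨w, hw⟩ := Option.isSome_iff_exists.1 hg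
  have hword := FreeGroup.toWord_append_of_norm_add (x := g⁻¹ * l) (y := l⁻¹ * k)
    (by simpa [mul_assoc] using hl)
  have hk' : config f w (g⁻¹ * k) = true := by
    rw [← config_mul hf hw]; simpa using hk
  rw [← mul_inv_cancel_left g l, config_mul hf hw]
  rw [show g⁻¹ * l * (l⁻¹ * k) = g⁻¹ * k by group] at hword
  rw [config, groupWalk, hword, walk_append] at hk'
  exact Option.isSome_of_isSome_bind hk'

theorem config_pattern (hf : ∀ t, (Sum.elim h v t).Injective)
    (hh : ∀ x, ∃! i, x ∈ Set.range (h i)) (hv : ∀ x, ∃! j, x ∈ Set.range (v j)) (z : X ⊕ Y)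
    {g : F n m} (hg : config (Sum.elim h v) z g = true) :
    PatternC1 (config (Sum.elim h v) z) g ∨ PatternC2 (config (Sum.elim h v) z) g := by
  obtain ⟨w, hw⟩ := Option.isSome_iff_exists.1 hg
  simp only [PatternC1, PatternC2, config_mul hf hw, a, b]
  rcases w with x | y
  · simp only [config_inl_of hf, config_inl_of_inv, Sum.elim_inl, Sum.elim_inr]
    exact .inl ⟨hh x, hv x, by simp, by simp⟩
  · simp [config_inr_of, config_inr_of_inv]

theorem config_mem_Omega (hf : ∀ t, (Sum.elim h v t).Injective)
    (hh : ∀ x, ∃! i, x ∈ Set.range (h i)) (hv : ∀ x, ∃! j, x ∈ Set.range (v j)) (z : X ⊕ Y) :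
    config (Sum.elim h v) z ∈ Omega n m :=
  ⟨config_one z, isConvexCfg_config hf z, fun _ => config_pattern hf hh hv z⟩

/-- A convex configuration omitting the first letter of a reduced word omits the whole word. -/
theorem IsConvexCfg.eq_false_of_cons {ξ : F n m → Bool} (hξ : IsConvexCfg ξ) (h₁ : ξ 1 = true)
    {s : (Fin n ⊕ Fin m) × Bool} {L : List ((Fin n ⊕ Fin m) × Bool)}
    (hL : FreeGroup.IsReduced (s :: L)) (hs : ξ (.mk [s]) = false) :
    ξ (.mk (s :: L)) = false := by
  by_contra hcon
  have hL' : FreeGroup.IsReduced L := hL.infix ⟨[s], [], by simp⟩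
  have hmul : (FreeGroup.mk [s])⁻¹ * FreeGroup.mk (s :: L) = FreeGroup.mk L := by
    rw [inv_mul_eq_iff_eq_mul, FreeGroup.mul_mk]; rfl
  have := hξ 1 (.mk (s :: L)) (.mk [s]) h₁ (by simpa using hcon) (by
    rw [hmul, inv_one, one_mul, one_mul]
    simp only [FreeGroup.norm, FreeGroup.toWord_mk, hL.reduce_eq, hL'.reduce_eq,
      FreeGroup.IsReduced.singleton.reduce_eq, List.length_nil, List.length_cons]
    omega)
  simp [hs] at this

theorem patternC2_one_of_mem_Yu (hn : 0 < n) {ξ : F n m → Bool} (hξ : ξ ∈ Yu n m) :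
    PatternC2 ξ 1 := by
  obtain ⟨⟨h₁, -, hp⟩, ha, -⟩ := hξ
  refine (hp 1 h₁).resolve_left fun hc => ?_
  simpa [ha] using hc.2.2.1 ⟨0, hn⟩

theorem patternC1_one_of_mem_Xu {ξ : F n m → Bool} (hξ : ξ ∈ Xu n m) : PatternC1 ξ 1 := by
  refine (hξ.1.2.2 1 hξ.1.1).resolve_right fun hc => hξ.2 ⟨hξ.1, ?_, ?_⟩
  · simpa using hc.2.2.1
  · simpa using hc.2.2.2

theorem eq_config_of_equivariant (hn : 0 < n) (hf : ∀ t, (Sum.elim h v t).Injective)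
    (hh : ∀ x, ∃! i, x ∈ Set.range (h i)) (hv : ∀ x, ∃! j, x ∈ Set.range (v j))
    {γ : X ⊕ Y → F n m → Bool} (hY : ∀ y, γ (.inr y) ∈ Yu n m) (hX : ∀ x, γ (.inl x) ∈ Xu n m)
    (ha : ∀ i y, γ (.inl (h i y)) = transl (a i) (γ (.inr y)))
    (hb : ∀ j y, γ (.inl (v j y)) = transl (b j) (γ (.inr y))) :
    γ = config (Sum.elim h v) := by
  have hΩ : ∀ z, γ z ∈ Omega n m := by
    rintro (x | y)
    exacts [(hX x).1, (hY y).1]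
  have hab : ∀ t y k, γ (.inl (Sum.elim h v t y)) k = γ (.inr y) ((.of t)⁻¹ * k) := by
    rintro (i | j) y k
    exacts [congrFun (ha i y) k, congrFun (hb j y) k]
  have hmem : ∀ t y, γ (.inl (Sum.elim h v t y)) (.of t) = true := fun t y => by
    rw [hab, inv_mul_cancel]; exact (hΩ _).1
  have hsome : ∀ (s : (Fin n ⊕ Fin m) × Bool) (z w : X ⊕ Y),
      letterStep (Sum.elim h v) s z = some w → ∀ k, γ z (.mk [s] * k) = γ w k := by
    rintro ⟨t, _ | _⟩ (x | y) w hw k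
    · simp [letterStep] at hw
    · obtain rfl : .inl (Sum.elim h v t y) = w := by
        simpa only [letterStep, Option.some.injEq] using hw
      exact (hab t y k).symm
    · obtain ⟨y, rfl, rfl⟩ := (letterStep_true_inl_eq_some hf).1 hw
      rw [hab]
      exact congrArg _ (inv_mul_cancel_left (FreeGroup.of t) k)
    · simp [letterStep] at hw
  have hnone : ∀ (s : (Fin n ⊕ Fin m) × Bool) (z : X ⊕ Y),
      letterStep (Sum.elim h v) s z = none → γ z (.mk [s]) = false := by
    rintro ⟨t, _ | _⟩ (x | y) hw
    · obtain ⟨-, -, ha', hb'⟩ := patternC1_one_of_mem_Xu (hX x)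
      simp only [one_mul] at ha' hb'
      rcases t with i | j
      exacts [ha' i, hb' j]
    · simp [letterStep] at hw
    · have hx : x ∉ Set.range (Sum.elim h v t) := by
        rw [← letterStep_isSome hf, hw]; simp
      obtain ⟨ha', hb', -, -⟩ := patternC1_one_of_mem_Xu (hX x)
      simp only [one_mul] at ha' hb'
      by_contra hcon
      rw [Bool.not_eq_false] at hcon
      rcases t with i | j
      · obtain ⟨i', ⟨y, rfl⟩, -⟩ := hh x
        obtain rfl := ha'.unique hcon (hmem (.inl i') y)
        exact hx ⟨y, rfl⟩
      · obtain ⟨j', ⟨y, rfl⟩, -⟩ := hv x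
        obtain rfl := hb'.unique hcon (hmem (.inr j') y)
        exact hx ⟨y, rfl⟩
    · obtain ⟨ha', hb', -, -⟩ := patternC2_one_of_mem_Yu hn (hY y)
      simp only [one_mul] at ha' hb'
      rcases t with i | j
      exacts [ha' i, hb' j]
  have hword : ∀ L : List ((Fin n ⊕ Fin m) × Bool), FreeGroup.IsReduced L →
      ∀ z, γ z (.mk L) = (walk (Sum.elim h v) L z).isSome := by
    intro L
    induction L with
    | nil => exact fun _ z => (hΩ z).1
    | cons s L ih =>
      intro hL z
      rw [walk]
      rcases hs : letterStep (Sum.elim h v) s z with _ | w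
      · exact (hΩ z).2.1.eq_false_of_cons (hΩ z).1 hL (hnone s z hs)
      · rw [Option.bind_some, ← ih (hL.infix ⟨[s], [], by simp⟩), ← hsome s z w hs,
          FreeGroup.mul_mk]
        rfl
  funext z g
  rw [config, groupWalk, ← hword _ FreeGroup.isReduced_toWord, FreeGroup.mk_toWord]

end Configurations

theorem existsUnique_mem_range {ι X Y : Type*} {H : ι → Set X} {h : ι → Y → X}
    (hdisj : ∀ i i', i ≠ i' → H i ∩ H i' = ∅) (hcover : (⋃ i, H i) = Set.univ)
    (hh : ∀ i, Set.range (h i) = H i) (x : X) : ∃! i, x ∈ Set.range (h i) := by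
  simp only [hh]
  obtain ⟨i, hi⟩ := Set.mem_iUnion.1 (hcover ▸ Set.mem_univ x)
  refine ⟨i, hi, fun i' hi' => ?_⟩
  by_contra hne
  exact (hdisj i' i hne).subset ⟨hi', hi⟩

theorem isClopen_image_of_isClopen_range {X Y : Type*} [TopologicalSpace X] [T2Space X]
    [TopologicalSpace Y] [CompactSpace Y] {f : Y → X} (hc : Continuous f) (hf : f.Injective)
    (hr : IsClopen (Set.range f)) {D : Set Y} (hD : IsClopen D) : IsClopen (f '' D) :=
  ⟨(hc.isClosedEmbedding hf).isClosedMap D hD.1,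
    (Topology.IsOpenEmbedding.mk (hc.isClosedEmbedding hf).isEmbedding hr.2).isOpenMap D hD.2⟩

/-- the standard `(m,n)`-dynamical system is universal. Given any
`(m,n)`-dynamical system `(X, Y, {h_i}, {v_j})` (with `X`, `Y` compact Hausdorff,
`H_i` pairwise disjoint clopen covering `X`, `V_j` pairwise disjoint clopen covering
`X`, and `h_i : Y → X`, `v_j : Y → X` continuous injective maps with ranges `H_i`,
`V_j` — i.e. homeomorphisms of `Y` onto `H_i`, resp. `V_j`), there is a unique
continuous map `γ : X ⊔ Y → Ω^u` with `γ(Y) ⊆ Y^u`, `γ(X) ⊆ X^u`,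
`γ ∘ h_i = h_i^u ∘ γ` and `γ ∘ v_j = v_j^u ∘ γ`. -/
theorem stmt_3 (n m : ℕ) (hn : 0 < n) (hm : 0 < m)
    (X Y : Type) [TopologicalSpace X] [CompactSpace X] [T2Space X]
    [TopologicalSpace Y] [CompactSpace Y] [T2Space Y]
    (H : Fin n → Set X) (V : Fin m → Set X)
    (h : Fin n → Y → X) (v : Fin m → Y → X)
    (hHclopen : ∀ i, IsClopen (H i))
    (hHdisj : ∀ i i', i ≠ i' → H i ∩ H i' = ∅)
    (hHcover : (⋃ i, H i) = Set.univ)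
    (hVclopen : ∀ j, IsClopen (V j))
    (hVdisj : ∀ j j', j ≠ j' → V j ∩ V j' = ∅)
    (hVcover : (⋃ j, V j) = Set.univ)
    (hh : ∀ i, Continuous (h i) ∧ Function.Injective (h i) ∧ Set.range (h i) = H i)
    (hv : ∀ j, Continuous (v j) ∧ Function.Injective (v j) ∧ Set.range (v j) = V j) :
    ∃! γ : X ⊕ Y → (F n m → Bool),
      Continuous γ ∧
      (∀ y : Y, γ (Sum.inr y) ∈ Yu n m) ∧
      (∀ x : X, γ (Sum.inl x) ∈ Xu n m) ∧
      (∀ (i : Fin n) (y : Y), γ (Sum.inl (h i y)) = transl (a i) (γ (Sum.inr y))) ∧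
      (∀ (j : Fin m) (y : Y), γ (Sum.inl (v j y)) = transl (b j) (γ (Sum.inr y))) := by
  have hf : ∀ t, (Sum.elim h v t).Injective := by
    rintro (i | j)
    exacts [(hh i).2.1, (hv j).2.1]
  have hc : ∀ t, Continuous (Sum.elim h v t) := by
    rintro (i | j)
    exacts [(hh i).1, (hv j).1]
  have hr : ∀ t, IsClopen (Set.range (Sum.elim h v t)) := by
    rintro (i | j)
    exacts [(hh i).2.2 ▸ hHclopen i, (hv j).2.2 ▸ hVclopen j]
  have hH := existsUnique_mem_range hHdisj hHcover fun i => (hh i).2.2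
  have hV := existsUnique_mem_range hVdisj hVcover fun j => (hv j).2.2
  have hΩ := config_mem_Omega hf hH hV
  refine ⟨config (Sum.elim h v), ⟨?_, fun y => ?_, fun x => ?_, fun i y => ?_, fun j y => ?_⟩, ?_⟩
  · exact continuous_config hf hc fun t D hD =>
      isClopen_image_of_isClopen_range (hc t) (hf t) (hr t) hD
  · exact ⟨hΩ _, fun i => config_inr_of_inv y _, fun j => config_inr_of_inv y _⟩
  · refine ⟨hΩ _, fun hx => ?_⟩
    have : config (Sum.elim h v) (.inl x) (a ⟨0, hn⟩)⁻¹ = false := config_inl_of_inv x _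
    simp [hx.2.1] at this
  · exact funext fun k => config_equivariant hf (.inl i) y k
  · exact funext fun k => config_equivariant hf (.inr j) y k
  · rintro γ ⟨-, hY, hX, ha, hb⟩
    exact eq_config_of_equivariant hn hf hH hV hY hX ha hb
end

section
/- If n ≥ m ≥ 2, then there exists a configuration ξ ∈ Y^u such that (b_1⁻¹a_1)·ξ = ξ and (b_2⁻¹a_2)·ξ = ξ; that is, the universal (m,n)-dynamical system has a point y ∈ Y^u with (v_1^u)⁻¹h_1^u(y) = y = (v_2^u)⁻¹h_2^u(y). -/
/-- The translate `g ξ = {g h : h ∈ ξ}` of a subset `ξ ⊆ F`. -/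
def transS {n m : ℕ} (g : F n m) (ξ : Set (F n m)) : Set (F n m) :=
  (fun h => g * h) '' ξ

/-- `ξ` is convex. -/
def IsConvexCfgS {n m : ℕ} (ξ : Set (F n m)) : Prop :=
  ∀ g ∈ ξ, ∀ h ∈ ξ, ∀ k : F n m,
    (g⁻¹ * k).norm + (k⁻¹ * h).norm = (g⁻¹ * h).norm → k ∈ ξ

/-- `ξ` has pattern (c1) at `g`. -/
def PatternC1S {n m : ℕ} (ξ : Set (F n m)) (g : F n m) : Prop :=
  (∃! i : Fin n, g * a i ∈ ξ) ∧ (∃! j : Fin m, g * b j ∈ ξ) ∧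
  (∀ i : Fin n, g * (a i)⁻¹ ∉ ξ) ∧ (∀ j : Fin m, g * (b j)⁻¹ ∉ ξ)

/-- `ξ` has pattern (c2) at `g`. -/
def PatternC2S {n m : ℕ} (ξ : Set (F n m)) (g : F n m) : Prop :=
  (∀ i : Fin n, g * a i ∉ ξ) ∧ (∀ j : Fin m, g * b j ∉ ξ) ∧
  (∀ i : Fin n, g * (a i)⁻¹ ∈ ξ) ∧ (∀ j : Fin m, g * (b j)⁻¹ ∈ ξ)

/-- The universal configuration space `Ω^u`. -/
def OmegaS (n m : ℕ) : Set (Set (F n m)) :=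
  {ξ | (1 : F n m) ∈ ξ ∧ IsConvexCfgS ξ ∧
    ∀ g ∈ ξ, PatternC1S ξ g ∨ PatternC2S ξ g}

/-- `Y^u`: the configurations with pattern (c2) at `1`. -/
def YuS (n m : ℕ) : Set (Set (F n m)) :=
  {ξ | ξ ∈ OmegaS n m ∧ (∀ i : Fin n, (a i)⁻¹ ∈ ξ) ∧ (∀ j : Fin m, (b j)⁻¹ ∈ ξ)}

namespace FreeGroup

variable {α : Type*}

section Convexity

variable [DecidableEq α]

theorem IsReduced.invRev {w : List (α × Bool)} (hw : IsReduced w) : IsReduced (invRev w) := by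
  rw [isReduced_iff_reduce_eq] at hw ⊢
  rw [reduce_invRev, hw]

/-- Two reduced words split off a common prefix so that the remaining tails meet without
cancellation. -/
theorem IsReduced.exists_common_prefix {u v : List (α × Bool)} (hu : IsReduced u)
    (hv : IsReduced v) :
    ∃ p u' v', u = p ++ u' ∧ v = p ++ v' ∧ IsReduced (FreeGroup.invRev u' ++ v') := by
  induction u generalizing v with
  | nil => exact ⟨[], [], v, rfl, rfl, hv⟩
  | cons x u ih =>
    cases v with
    | nil => exact ⟨[], x :: u, [], rfl, rfl, by simpa using hu.invRev⟩
    | cons y v =>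
      by_cases hxy : x = y
      · subst hxy
        obtain ⟨p, u', v', rfl, rfl, h⟩ :=
          ih (hu.infix (List.suffix_cons x u).isInfix) (hv.infix (List.suffix_cons x v).isInfix)
        exact ⟨x :: p, u', v', rfl, rfl, h⟩
      · refine ⟨[], x :: u, y :: v, rfl, rfl, List.isChain_append.2 ⟨hu.invRev, hv, ?_⟩⟩
        obtain ⟨x₁, x₂⟩ := x
        obtain ⟨y₁, y₂⟩ := y
        simp only [FreeGroup.invRev, List.map_cons, List.reverse_cons, List.getLast?_append,
          List.getLast?_singleton, Option.some_or, List.head?_cons, Option.mem_def,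
          Option.some.injEq]
        rintro _ rfl _ rfl rfl
        cases x₂ <;> cases y₂ <;> simp_all

theorem toWord_mul_of_norm_eq {x y : FreeGroup α} (h : x.norm + y.norm = (x * y).norm) :
    (x * y).toWord = x.toWord ++ y.toWord :=
  (toWord_mul_sublist x y).eq_of_length (by simpa [norm] using h.symm)

/-- A set of elements closed under passing to prefixes of reduced words is geodesically convex. -/
theorem mem_of_norm_add_eq {ξ : Set (FreeGroup α)}
    (hξ : ∀ u v, IsReduced (u ++ v) → mk (u ++ v) ∈ ξ → mk u ∈ ξ)
    {g h k : FreeGroup α} (hg : g ∈ ξ) (hh : h ∈ ξ)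
    (hk : (g⁻¹ * k).norm + (k⁻¹ * h).norm = (g⁻¹ * h).norm) : k ∈ ξ := by
  obtain ⟨p, u, v, hgu, hhv, huv⟩ :=
    (isReduced_toWord (x := g)).exists_common_prefix (isReduced_toWord (x := h))
  have hg' : g = mk p * mk u := by rw [mul_mk, ← hgu, mk_toWord]
  have hh' : h = mk p * mk v := by rw [mul_mk, ← hhv, mk_toWord]
  have hgh : (g⁻¹ * h).toWord = invRev u ++ v := by
    have : g⁻¹ * h = mk (invRev u ++ v) := by
      rw [hg', hh', ← mul_mk, ← inv_mk]
      group
    rw [this, toWord_mk, huv.reduce_eq]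
  have hmul : g⁻¹ * k * (k⁻¹ * h) = g⁻¹ * h := by group
  have hw := toWord_mul_of_norm_eq (x := g⁻¹ * k) (y := k⁻¹ * h) (by rw [hk, hmul])
  rw [hmul, hgh] at hw
  have hgk : k = g * mk (g⁻¹ * k).toWord := by rw [mk_toWord]; group
  obtain ⟨c, hc, -⟩ | ⟨c, hc, -⟩ := List.append_eq_append_iff.1 hw
  · have hv : v = c ++ (k⁻¹ * h).toWord := by
      rw [hc, List.append_assoc] at hw
      exact List.append_cancel_left hw
    have hkc : k = mk (p ++ c) := by
      rw [hgk, hc, hg', ← mul_mk, ← mul_mk, ← inv_mk]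
      group
    rw [hkc]
    refine hξ _ (k⁻¹ * h).toWord ?_ ?_
    · rw [List.append_assoc, ← hv, ← hhv]
      exact isReduced_toWord
    · rwa [List.append_assoc, ← hv, ← hhv, mk_toWord]
  · have hu : u = invRev c ++ invRev (g⁻¹ * k).toWord := by
      rw [← invRev_append, ← hc, invRev_invRev]
    have hkc : k = mk (p ++ invRev c) := by
      nth_rw 1 [hgk]
      nth_rw 1 [hg', hu]
      rw [← mul_mk, ← mul_mk, ← inv_mk (L := (g⁻¹ * k).toWord)]
      group
    rw [hkc]
    refine hξ _ (invRev (g⁻¹ * k).toWord) ?_ ?_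
    · rw [List.append_assoc, ← hu, ← hgu]
      exact isReduced_toWord
    · rwa [List.append_assoc, ← hu, ← hgu, mk_toWord]

end Convexity

/-- In an alternating word, an inverse letter `x⁻¹` is followed by `φ x`, and a positive letter `x`
by some `y⁻¹` with `y ≠ x`. -/
def AlternatingStep (φ : α → α) (p q : α × Bool) : Prop :=
  (p.2 = false ∧ q.2 = true ∧ q.1 = φ p.1) ∨ (p.2 = true ∧ q.2 = false ∧ p.1 ≠ q.1)

/-- The words `x₁⁻¹ (φ x₁) x₂⁻¹ (φ x₂) ⋯` with `x_{k+1} ≠ φ x_k`, of even or odd length. -/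
def IsAlternating (φ : α → α) (w : List (α × Bool)) : Prop :=
  w.IsChain (AlternatingStep φ) ∧ ∀ p ∈ w.head?, p.2 = false

variable {φ : α → α} {u v w : List (α × Bool)}

theorem IsAlternating.nil : IsAlternating φ [] := by simp [IsAlternating]

theorem IsAlternating.singleton (x : α) : IsAlternating φ [(x, false)] := by simp [IsAlternating]

theorem IsAlternating.isReduced (hφ : ∀ x, φ x ≠ x) (hw : IsAlternating φ w) : IsReduced w := by
  refine hw.1.imp ?_
  rintro ⟨x, s⟩ ⟨y, t⟩ (⟨-, -, h⟩ | ⟨-, -, h⟩) hxy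
  · exact absurd (h.symm.trans hxy.symm) (hφ x)
  · exact absurd hxy h

theorem IsAlternating.of_append (h : IsAlternating φ (u ++ v)) : IsAlternating φ u := by
  refine ⟨(List.isChain_append.1 h.1).1, fun p hp => h.2 p ?_⟩
  cases u <;> simp_all

theorem isAlternating_append_singleton_pair {p q : α × Bool} :
    IsAlternating φ (w ++ [p] ++ [q]) ↔ IsAlternating φ (w ++ [p]) ∧ AlternatingStep φ p q := by
  cases w
  · simp [IsAlternating, and_comm]
  · simp [IsAlternating, and_right_comm]

theorem isAlternating_cons_cons {x y : α} :
    IsAlternating φ ((x, false) :: (y, true) :: w) ↔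
      y = φ x ∧ IsAlternating φ w ∧ ∀ p ∈ w.head?, y ≠ p.1 := by
  cases w
  · simp [IsAlternating, AlternatingStep]
  · simp [IsAlternating, AlternatingStep]
    tauto

theorem isReduced_append_singleton_pair {p q : α × Bool} :
    IsReduced (w ++ [p] ++ [q]) ↔ IsReduced (w ++ [p]) ∧ (p.1 = q.1 → p.2 = q.2) := by
  simp only [IsReduced, List.isChain_append, List.getLast?_append, List.getLast?_singleton]
  simp

variable [DecidableEq α]

/-- The elements whose reduced word is alternating. -/
def alternatingSet (φ : α → α) : Set (FreeGroup α) := {g | IsAlternating φ g.toWord}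

theorem mk_mem_alternatingSet (hw : IsReduced w) :
    mk w ∈ alternatingSet φ ↔ IsAlternating φ w := by
  rw [alternatingSet, Set.mem_ofPred_eq, toWord_mk, hw.reduce_eq]

theorem IsAlternating.mk_mem (hφ : ∀ x, φ x ≠ x) (hw : IsAlternating φ w) :
    mk w ∈ alternatingSet φ :=
  (mk_mem_alternatingSet (hw.isReduced hφ)).2 hw

/-- Around each element of `alternatingSet φ`, either only the incoming edges stay inside, or only
the outgoing edges labelled `x` and `φ x` do. -/
theorem alternatingSet_local (hφ : ∀ x, φ x ≠ x) {g : FreeGroup α} (hg : g ∈ alternatingSet φ) :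
    (∃ x, (∀ z, g * of z ∈ alternatingSet φ ↔ z = x ∨ z = φ x) ∧
      ∀ z, g * (of z)⁻¹ ∉ alternatingSet φ) ∨
    ((∀ z, g * of z ∉ alternatingSet φ) ∧ ∀ z, g * (of z)⁻¹ ∈ alternatingSet φ) := by
  obtain ⟨w, hw, rfl⟩ : ∃ w, IsAlternating φ w ∧ mk w = g := ⟨g.toWord, hg, mk_toWord⟩
  have hof (z : α) : mk w * of z = mk (w ++ [(z, true)]) := mul_mk
  have hinv (z : α) : mk w * (of z)⁻¹ = mk (w ++ [(z, false)]) := mul_mk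
  rcases List.eq_nil_or_concat' w with rfl | ⟨w, ⟨x, s⟩, rfl⟩
  · right
    refine ⟨fun z => ?_, fun z => ?_⟩
    · rw [hof, mk_mem_alternatingSet (by simp)]
      simp [IsAlternating]
    · rw [hinv]
      exact (IsAlternating.singleton z).mk_mem hφ
  have hred := hw.isReduced hφ
  cases s
  · left
    refine ⟨x, fun z => ?_, fun z => ?_⟩
    · by_cases hz : z = x
      · subst hz
        have : mk (w ++ [(z, false)]) * of z = mk w := by
          rw [← mul_mk, show mk [(z, false)] = (of z)⁻¹ from rfl, inv_mul_cancel_right]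
        simpa [this] using hw.of_append.mk_mem hφ
      · rw [hof, mk_mem_alternatingSet (isReduced_append_singleton_pair.2
          ⟨hred, fun h => absurd h.symm hz⟩), isAlternating_append_singleton_pair]
        simp [hw, hz, AlternatingStep]
    · rw [hinv, mk_mem_alternatingSet (isReduced_append_singleton_pair
          (q := (z, false)).2 ⟨hred, fun _ => rfl⟩),
        isAlternating_append_singleton_pair]
      simp [AlternatingStep]
  · right
    refine ⟨fun z => ?_, fun z => ?_⟩
    · rw [hof, mk_mem_alternatingSet (isReduced_append_singleton_pair
          (q := (z, true)).2 ⟨hred, fun _ => rfl⟩),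
        isAlternating_append_singleton_pair]
      simp [AlternatingStep]
    · by_cases hz : x = z
      · subst hz
        have : mk (w ++ [(x, true)]) * (of x)⁻¹ = mk w := by
          rw [← mul_mk, show mk [(x, true)] = of x from rfl, mul_inv_cancel_right]
        rw [this]
        exact hw.of_append.mk_mem hφ
      · rw [hinv]
        exact (isAlternating_append_singleton_pair.2
          ⟨hw, by simp [AlternatingStep, hz]⟩).mk_mem hφ

theorem inv_of_mul_of_mul_mem_alternatingSet (hφ : ∀ x, φ x ≠ x) {x y : α} (hxy : φ x = y)
    (hyx : φ y = x) {g : FreeGroup α} (hg : g ∈ alternatingSet φ) :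
    (of x)⁻¹ * of y * g ∈ alternatingSet φ := by
  obtain ⟨w, hw, rfl⟩ : ∃ w, IsAlternating φ w ∧ mk w = g := ⟨g.toWord, hg, mk_toWord⟩
  have hmul : (of x)⁻¹ * of y * mk w = mk ((x, false) :: (y, true) :: w) := rfl
  by_cases h : ∀ p ∈ w.head?, y ≠ p.1
  · rw [hmul]
    exact (isAlternating_cons_cons.2 ⟨hxy.symm, hw, h⟩).mk_mem hφ
  · rcases w with _ | ⟨⟨z, s⟩, w⟩
    · simp at h
    obtain rfl : y = z := by simpa using h
    obtain rfl : s = false := by simpa using hw.2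
    rcases w with _ | ⟨⟨z, t⟩, w⟩
    · have : (of x)⁻¹ * of y * mk [(y, false)] = mk [(x, false)] := by
        rw [show mk [(y, false)] = (of y)⁻¹ from rfl, mul_inv_cancel_right]
        rfl
      rw [this]
      exact (IsAlternating.singleton x).mk_mem hφ
    · obtain rfl : t = true := by
        have := hw.1
        simp [AlternatingStep] at this
        exact this.1.1
      obtain ⟨rfl, hw', -⟩ := isAlternating_cons_cons.1 hw
      have : (of x)⁻¹ * of y * mk ((y, false) :: (φ y, true) :: w) = mk w := by
        rw [hyx, show mk ((y, false) :: (x, true) :: w) = (of y)⁻¹ * of x * mk w from rfl]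
        group
      rw [this]
      exact hw'.mk_mem hφ

end FreeGroup

open FreeGroup in
theorem alternatingSet_mem_YuS {n m : ℕ} (f : Fin n → Fin m) (e : Fin m → Fin n) :
    alternatingSet (Sum.elim (Sum.inr ∘ f) (Sum.inl ∘ e)) ∈ YuS n m := by
  set φ : Fin n ⊕ Fin m → Fin n ⊕ Fin m := Sum.elim (Sum.inr ∘ f) (Sum.inl ∘ e)
  have hφ : ∀ x, φ x ≠ x := by rintro (i | j) <;> simp [φ]
  refine ⟨⟨IsAlternating.nil.mk_mem hφ, fun g hg h hh k hk => ?_, fun g hg => ?_⟩,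
    fun i => (IsAlternating.singleton _).mk_mem hφ, fun j => (IsAlternating.singleton _).mk_mem hφ⟩
  · exact mem_of_norm_add_eq (fun u v huv h =>
      ((mk_mem_alternatingSet huv).1 h).of_append.mk_mem hφ) hg hh hk
  · rcases alternatingSet_local hφ hg with ⟨x, hx, hinv⟩ | ⟨hof, hinv⟩
    · left
      refine ⟨?_, ?_, fun i => hinv _, fun j => hinv _⟩ <;> simp only [a, b, hx] <;>
        rcases x with i | j <;> simp [φ]
    · exact Or.inr ⟨fun i => hof _, fun j => hof _, fun i => hinv _, fun j => hinv _⟩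

open FreeGroup in
theorem transS_alternatingSet {n m : ℕ} {f : Fin n → Fin m} {e : Fin m → Fin n} {i : Fin n}
    {j : Fin m} (hf : f i = j) (he : e j = i) :
    transS ((b j)⁻¹ * a i) (alternatingSet (Sum.elim (Sum.inr ∘ f) (Sum.inl ∘ e))) =
      alternatingSet (Sum.elim (Sum.inr ∘ f) (Sum.inl ∘ e)) := by
  have hφ : ∀ x, Sum.elim (Sum.inr ∘ f) (Sum.inl ∘ e) x ≠ x := by rintro (i | j) <;> simp
  refine Set.Subset.antisymm ?_ fun g hg => ⟨(a i)⁻¹ * b j * g, ?_, by simp only; group⟩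
  · rintro _ ⟨g, hg, rfl⟩
    exact inv_of_mul_of_mul_mem_alternatingSet hφ (by simp [he]) (by simp [hf]) hg
  · exact inv_of_mul_of_mul_mem_alternatingSet hφ (by simp [hf]) (by simp [he]) hg

/-- if `n ≥ m ≥ 2` there is a configuration `ξ ∈ Y^u` fixed by the
translations by `b_1⁻¹ a_1` and `b_2⁻¹ a_2`, i.e. a point `y ∈ Y^u` with
`(v_1^u)⁻¹ h_1^u(y) = y = (v_2^u)⁻¹ h_2^u(y)`. -/
theorem stmt_4 (n m : ℕ) (hm : 2 ≤ m) (hmn : m ≤ n) :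
    ∃ ξ ∈ YuS n m,
      transS ((b (⟨0, by omega⟩ : Fin m))⁻¹ * a (⟨0, by omega⟩ : Fin n)) ξ = ξ ∧
      transS ((b (⟨1, by omega⟩ : Fin m))⁻¹ * a (⟨1, by omega⟩ : Fin n)) ξ = ξ := by
  refine ⟨_, alternatingSet_mem_YuS
    (fun i => if h : (i : ℕ) < m then ⟨i, h⟩ else ⟨0, by omega⟩) (Fin.castLE hmn),
    transS_alternatingSet ?_ rfl, transS_alternatingSet ?_ rfl⟩
  · simp [show 0 < m by omega]
  · simp [show 1 < m by omega]
end

section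
/- Given an E-function (Ω_1,f_1),(Ω_2,f_2),…, there is a unique function f ∈ D such that f(α) = f_i(α) for every α ∈ Ω_i and every i ∈ ℕ. -/
/-- The alphabet `E = Z_0 ⊔ Z_1`, with `Z_0 = {a_1,…,a_n}` and `Z_1 = {b_1,…,b_m}`. -/
abbrev E (n m : ℕ) : Type := Fin n ⊕ Fin m

/-- `E^+`: nonempty finite words over `E`. -/
abbrev Word (n m : ℕ) : Type := {l : List (E n m) // l ≠ []}

theorem ne_nil_append_singleton {γ : Type*} (α : List γ) (e : γ) : α ++ [e] ≠ [] := by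
  simp

theorem ne_nil_append {γ : Type*} (α : List γ) {β : List γ} (hβ : β ≠ []) :
    α ++ β ≠ [] := by
  simp [hβ]

/-- `e` has the color prescribed for words ending as `w` does: `e ∈ Z_{c(w)}`,
i.e. `e` lies on the opposite side of the sum from the last letter of `w`. -/
def colorOK {n m : ℕ} (w : Word n m) (e : E n m) : Prop :=
  e.isLeft = !(w.1.getLast w.2).isLeft

/-- The space `Z = ∏_{α ∈ E^+} Z_{c(α)}` of color-respecting functions `E^+ → E`. -/
def Zset (n m : ℕ) : Set (Word n m → E n m) :=
  {f | ∀ w : Word n m, colorOK w (f w)}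

/-- Condition (*): `f(α e f(α e)) = e`. -/
def starCond {n m : ℕ} (f : Word n m → E n m) : Prop :=
  ∀ (α : List (E n m)) (e : E n m),
    f ⟨(α ++ [e]) ++ [f ⟨α ++ [e], ne_nil_append_singleton α e⟩],
        ne_nil_append_singleton _ _⟩ = e

/-- Condition (**): `f(α e f(α e) β) = f(α β)`. -/
def starStarCond {n m : ℕ} (f : Word n m → E n m) : Prop :=
  ∀ (α : List (E n m)) (e : E n m) (β : Word n m),
    f ⟨((α ++ [e]) ++ [f ⟨α ++ [e], ne_nil_append_singleton α e⟩]) ++ β.1,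
        ne_nil_append _ β.2⟩
      = f ⟨α ++ β.1, ne_nil_append _ β.2⟩

/-- The subspace `D ⊆ Z` of functions satisfying (*) and (**). -/
def Dset (n m : ℕ) : Set (Word n m → E n m) :=
  {f | f ∈ Zset n m ∧ starCond f ∧ starStarCond f}

theorem take_ne_nil {γ : Type*} (l : List γ) (k : ℕ) (hk : 0 < k) (hl : l ≠ []) :
    l.take k ≠ [] := by
  cases l with
  | nil => exact absurd rfl hl
  | cons x xs =>
    cases k with
    | zero => omega
    | succ k => simp

/-- `Ω_r(F)`, for all `r` at once: the words `x_1 ⋯ x_r` such that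
`x_{k+1} ≠ F(x_1 ⋯ x_k)` for `k = 1, …, r-1`. -/
def EOmega {n m : ℕ} (F : Word n m → E n m) : Set (Word n m) :=
  {w | ∀ (k : ℕ) (hk0 : 0 < k) (hk : k < w.1.length),
        w.1.get ⟨k, hk⟩ ≠ F ⟨w.1.take k, take_ne_nil w.1 k hk0 w.2⟩}

/-- An `E`-function, encoded as a (total) function on words whose defining
color condition is imposed on the sets `Ω_r`. -/
def IsEFunction {n m : ℕ} (F : Word n m → E n m) : Prop :=
  ∀ w ∈ EOmega F, colorOK w (F w)

/-- A partial `E`-function `(Ω_1,f_1),…,(Ω_r,f_r)`, encoded as a (total)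
function on words whose defining color condition is imposed on the words of
`Ω_1, …, Ω_r`, i.e. on words of length at most `r`. -/
def IsPartialEFunction {n m : ℕ} (r : ℕ) (F : Word n m → E n m) : Prop :=
  1 ≤ r ∧ ∀ w ∈ EOmega F, w.1.length ≤ r → colorOK w (F w)

namespace EReduction

variable {n m : ℕ}

/-- The value of `F` at the word whose reversal is `x :: s`. -/
def stackValue (F : Word n m → E n m) (x : E n m) (s : List (E n m)) : E n m :=
  F ⟨s.reverse ++ [x], ne_nil_append_singleton _ _⟩

/-- Reading the letter `x` in the state `s`, a reversed reduced word: the top letter is cancelled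
if `x` is the value of `F` there, and otherwise `x` is pushed. -/
def step (F : Word n m → E n m) : List (E n m) → E n m → List (E n m)
  | [], x => [x]
  | g :: t, x => if x = stackValue F g t then t else x :: g :: t

/-- The value attached to reading `x` in the state `s`: the cancelled letter if there is one,
and otherwise the value of `F` at the new state. -/
def output (F : Word n m → E n m) : List (E n m) → E n m → E n m
  | [], x => stackValue F x []
  | g :: t, x => if x = stackValue F g t then g else stackValue F x (g :: t)

/-- The reversal of the reduced form of a word. -/
def reduction (F : Word n m → E n m) (α : List (E n m)) : List (E n m) :=
  α.foldl (step F) []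

/-- The extension of an `E`-function to all words. -/
def extend (F : Word n m → E n m) (w : Word n m) : E n m :=
  output F (reduction F w.1.dropLast) (w.1.getLast w.2)

/-- The reversed words lying in `Ω(F)`, together with the empty word. -/
def IsReduced (F : Word n m → E n m) : List (E n m) → Prop
  | [] => True
  | [_] => True
  | x :: g :: t => x ≠ stackValue F g t ∧ IsReduced F (g :: t)

theorem singleton_mem_EOmega (F : Word n m → E n m) (x : E n m) (h : [x] ≠ []) :
    (⟨[x], h⟩ : Word n m) ∈ EOmega F := by
  intro k hk0 hk
  simp at hk
  omega

theorem append_singleton_mem_EOmega_iff (F : Word n m → E n m) (α : List (E n m))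
    (hα : α ≠ []) (x : E n m) :
    (⟨α ++ [x], ne_nil_append_singleton α x⟩ : Word n m) ∈ EOmega F ↔
      x ≠ F ⟨α, hα⟩ ∧ (⟨α, hα⟩ : Word n m) ∈ EOmega F := by
  have hpos := List.length_pos_iff.2 hα
  constructor
  · intro h
    refine ⟨?_, fun k hk0 hk => ?_⟩
    · simpa using h α.length hpos (by simp)
    · have hk' : k < α.length := hk
      simpa [List.getElem_append_left hk', List.take_append_of_le_length hk'.le] using
        h k hk0 (by simp; omega)
  · rintro ⟨hx, h⟩ k hk0 hk
    simp only [List.length_append, List.length_singleton] at hk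
    obtain hk' | rfl : k < α.length ∨ k = α.length := by omega
    · simpa [List.getElem_append_left hk', List.take_append_of_le_length hk'.le] using
        h k hk0 hk'
    · simpa using hx

theorem isReduced_cons_iff (F : Word n m → E n m) (x : E n m) (s : List (E n m)) :
    IsReduced F (x :: s) ↔
      (⟨s.reverse ++ [x], ne_nil_append_singleton _ _⟩ : Word n m) ∈ EOmega F := by
  induction s generalizing x with
  | nil => simpa [IsReduced] using singleton_mem_EOmega F x _
  | cons g t ih =>
    rw [append_singleton_mem_EOmega_iff F _ (by simp)]
    simp only [IsReduced, stackValue, List.reverse_cons, ih]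

theorem IsReduced.tail {F : Word n m → E n m} {x : E n m} {s : List (E n m)}
    (h : IsReduced F (x :: s)) : IsReduced F s := by
  cases s with
  | nil => trivial
  | cons g t => exact h.2

theorem IsReduced.step {F : Word n m → E n m} {s : List (E n m)} (h : IsReduced F s)
    (x : E n m) : IsReduced F (step F s x) := by
  cases s with
  | nil => trivial
  | cons g t =>
    rw [EReduction.step]
    split_ifs with hx
    · exact h.tail
    · exact ⟨hx, h⟩

theorem reduction_append_singleton (F : Word n m → E n m) (α : List (E n m)) (x : E n m) :
    reduction F (α ++ [x]) = step F (reduction F α) x := by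
  simp [reduction]

theorem isReduced_reduction (F : Word n m → E n m) (α : List (E n m)) :
    IsReduced F (reduction F α) := by
  induction α using List.reverseRecOn with
  | nil => trivial
  | append_singleton α x ih =>
    rw [reduction_append_singleton]
    exact ih.step x

theorem step_eq_cons_of_isReduced {F : Word n m → E n m} {x : E n m} {s : List (E n m)}
    (h : IsReduced F (x :: s)) : step F s x = x :: s := by
  cases s with
  | nil => rfl
  | cons g t => exact if_neg h.1

theorem output_eq_of_isReduced {F : Word n m → E n m} {x : E n m} {s : List (E n m)}
    (h : IsReduced F (x :: s)) : output F s x = stackValue F x s := by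
  cases s with
  | nil => rfl
  | cons g t => exact if_neg h.1

theorem reduction_reverse_of_isReduced {F : Word n m → E n m} {s : List (E n m)}
    (h : IsReduced F s) : reduction F s.reverse = s := by
  induction s with
  | nil => rfl
  | cons x s ih =>
    rw [List.reverse_cons, reduction_append_singleton, ih h.tail, step_eq_cons_of_isReduced h]

theorem isReduced_cons_or_cancel {F : Word n m → E n m} {s : List (E n m)}
    (h : IsReduced F s) (x : E n m) :
    IsReduced F (x :: s) ∨ ∃ g t, s = g :: t ∧ x = stackValue F g t := by
  cases s with
  | nil => exact Or.inl trivial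
  | cons g t =>
    by_cases hx : x = stackValue F g t
    · exact Or.inr ⟨g, t, rfl, hx⟩
    · exact Or.inl ⟨hx, h⟩

theorem step_stackValue (F : Word n m → E n m) (g : E n m) (t : List (E n m)) :
    step F (g :: t) (stackValue F g t) = t := if_pos rfl

theorem output_stackValue (F : Word n m → E n m) (g : E n m) (t : List (E n m)) :
    output F (g :: t) (stackValue F g t) = g := if_pos rfl

theorem step_output {F : Word n m → E n m} {s : List (E n m)} (h : IsReduced F s)
    (x : E n m) : step F (step F s x) (output F s x) = s := by
  obtain hx | ⟨g, t, rfl, rfl⟩ := isReduced_cons_or_cancel h x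
  · rw [step_eq_cons_of_isReduced hx, output_eq_of_isReduced hx, step_stackValue]
  · rw [step_stackValue, output_stackValue, step_eq_cons_of_isReduced h]

theorem output_output {F : Word n m → E n m} {s : List (E n m)} (h : IsReduced F s)
    (x : E n m) : output F (step F s x) (output F s x) = x := by
  obtain hx | ⟨g, t, rfl, rfl⟩ := isReduced_cons_or_cancel h x
  · rw [step_eq_cons_of_isReduced hx, output_eq_of_isReduced hx, output_stackValue]
  · rw [step_stackValue, output_stackValue, output_eq_of_isReduced h]

theorem extend_append_singleton (F : Word n m → E n m) (α : List (E n m)) (x : E n m)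
    (h : α ++ [x] ≠ []) : extend F ⟨α ++ [x], h⟩ = output F (reduction F α) x := by
  simp [extend]

theorem reduction_append_extend (F : Word n m → E n m) (α : List (E n m)) (x : E n m) :
    reduction F (α ++ [x] ++ [extend F ⟨α ++ [x], ne_nil_append_singleton α x⟩]) =
      reduction F α := by
  rw [reduction_append_singleton, extend_append_singleton, reduction_append_singleton,
    step_output (isReduced_reduction F α)]

theorem exists_eq_append_singleton (w : Word n m) :
    ∃ α x, w = ⟨α ++ [x], ne_nil_append_singleton α x⟩ :=
  ⟨w.1.dropLast, w.1.getLast w.2, Subtype.ext (List.dropLast_append_getLast w.2).symm⟩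

theorem isLeft_stackValue {F : Word n m → E n m} (hF : IsEFunction F) {x : E n m}
    {s : List (E n m)} (h : IsReduced F (x :: s)) :
    (stackValue F x s).isLeft = !x.isLeft := by
  simpa [colorOK, stackValue] using hF _ ((isReduced_cons_iff F x s).1 h)

theorem isLeft_output {F : Word n m → E n m} (hF : IsEFunction F) {s : List (E n m)}
    (h : IsReduced F s) (x : E n m) : (output F s x).isLeft = !x.isLeft := by
  obtain hx | ⟨g, t, rfl, rfl⟩ := isReduced_cons_or_cancel h x
  · rw [output_eq_of_isReduced hx, isLeft_stackValue hF hx]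
  · rw [output_stackValue, isLeft_stackValue hF h, Bool.not_not]

theorem extend_mem_Dset {F : Word n m → E n m} (hF : IsEFunction F) :
    extend F ∈ Dset n m := by
  refine ⟨fun w => ?_, fun α e => ?_, fun α e β => ?_⟩
  · obtain ⟨α, x, rfl⟩ := exists_eq_append_singleton w
    rw [extend_append_singleton]
    simpa [colorOK] using isLeft_output hF (isReduced_reduction F α) x
  · rw [extend_append_singleton, extend_append_singleton, reduction_append_singleton,
      output_output (isReduced_reduction F α)]
  · obtain ⟨γ, x, rfl⟩ := exists_eq_append_singleton β
    simp only [← List.append_assoc _ γ [x], extend_append_singleton F (_ ++ γ) x]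
    have h := reduction_append_extend F α e
    unfold reduction at h ⊢
    rw [List.foldl_append (l' := γ), h, List.foldl_append (l' := γ)]

theorem extend_eq_of_mem_EOmega (F : Word n m → E n m) {w : Word n m} (hw : w ∈ EOmega F) :
    extend F w = F w := by
  obtain ⟨α, x, rfl⟩ := exists_eq_append_singleton w
  have h : IsReduced F (x :: α.reverse) := by
    rw [isReduced_cons_iff]
    simpa using hw
  have hα := reduction_reverse_of_isReduced h.tail
  rw [List.reverse_reverse] at hα
  rw [extend_append_singleton, hα, output_eq_of_isReduced h]
  simp [stackValue]

theorem apply_eq_stackValue {F f : Word n m → E n m} (hfF : ∀ w ∈ EOmega F, f w = F w)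
    {x : E n m} {s : List (E n m)} (h : IsReduced F (x :: s)) :
    f ⟨s.reverse ++ [x], ne_nil_append_singleton _ _⟩ = stackValue F x s :=
  hfF _ ((isReduced_cons_iff F x s).1 h)

theorem apply_append_eq_reduction {F f : Word n m → E n m} (hf : starStarCond f)
    (hfF : ∀ w ∈ EOmega F, f w = F w) (α β : List (E n m)) (hβ : β ≠ []) :
    f ⟨α ++ β, ne_nil_append α hβ⟩ =
      f ⟨(reduction F α).reverse ++ β, ne_nil_append _ hβ⟩ := by
  induction α using List.reverseRecOn generalizing β with
  | nil => rfl
  | append_singleton α x ih =>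
    have hs := isReduced_reduction F α
    have key := ih ([x] ++ β) (by simp)
    simp only [← List.append_assoc] at key
    rw [key, reduction_append_singleton]
    obtain hx | ⟨g, t, hgt, rfl⟩ := isReduced_cons_or_cancel hs x
    · simp only [step_eq_cons_of_isReduced hx, List.reverse_cons]
    · rw [hgt] at hs
      simp only [hgt, step_stackValue, List.reverse_cons]
      simpa only [apply_eq_stackValue hfF hs] using hf t.reverse g ⟨β, hβ⟩

theorem eq_extend {F f : Word n m → E n m} (hf : f ∈ Dset n m)
    (hfF : ∀ w ∈ EOmega F, f w = F w) : f = extend F := by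
  obtain ⟨-, hstar, hstarstar⟩ := hf
  funext w
  obtain ⟨α, x, rfl⟩ := exists_eq_append_singleton w
  have hs := isReduced_reduction F α
  rw [extend_append_singleton,
    apply_append_eq_reduction hstarstar hfF α [x] (List.cons_ne_nil _ _)]
  obtain hx | ⟨g, t, hgt, rfl⟩ := isReduced_cons_or_cancel hs x
  · rw [output_eq_of_isReduced hx, apply_eq_stackValue hfF hx]
  · rw [hgt] at hs
    simp only [hgt, output_stackValue, List.reverse_cons]
    simpa only [apply_eq_stackValue hfF hs] using hstar t.reverse g

end EReduction

/-- given an `E`-function `(Ω_1,f_1),(Ω_2,f_2),…`, there is a unique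
`f ∈ D` such that `f(α) = f_i(α)` for every `α ∈ Ω_i` and every `i`. -/
theorem stmt_6 (n m : ℕ) (hn : 0 < n) (hm : 0 < m)
    (F : Word n m → E n m) (hF : IsEFunction F) :
    ∃! f : Word n m → E n m, f ∈ Dset n m ∧ ∀ w ∈ EOmega F, f w = F w :=
  ⟨EReduction.extend F,
    ⟨EReduction.extend_mem_Dset hF, fun _ hw => EReduction.extend_eq_of_mem_EOmega F hw⟩,
    fun _ hf => EReduction.eq_extend hf.1 hf.2⟩
end

section
/- Every partial E-function (Ω_1,f_1),…,(Ω_r,f_r) can be extended to an E-function (Ω_1,f_1),(Ω_2,f_2),…; consequently, for every partial E-function 𝔣 the set U_𝔣 = {f ∈ D : f extends 𝔣} is nonempty, and in particular D is nonempty. -/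
theorem exists_colorOK {n m : ℕ} (hn : 0 < n) (hm : 0 < m) (w : Word n m) :
    ∃ e : E n m, colorOK w e := by
  unfold colorOK
  cases (w.1.getLast w.2).isLeft
  · exact ⟨Sum.inl ⟨0, hn⟩, rfl⟩
  · exact ⟨Sum.inr ⟨0, hm⟩, rfl⟩

/-- Every function on words agrees with a color-respecting one wherever it respects colors. -/
theorem exists_mem_Zset_eq {n m : ℕ} (hn : 0 < n) (hm : 0 < m) (F : Word n m → E n m) :
    ∃ G ∈ Zset n m, ∀ w, colorOK w (F w) → G w = F w := by
  classical
  choose d hd using exists_colorOK hn hm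
  refine ⟨fun w => if colorOK w (F w) then F w else d w, fun w => ?_, fun w hw => if_pos hw⟩
  dsimp only
  split_ifs with h
  · exact h
  · exact hd w

section Reduction

variable {n m : ℕ} (G : Word n m → E n m)

/-- A word no letter of which is the value of `G` at the nonempty prefix preceding it. -/
def Reduced (s : List (E n m)) : Prop :=
  ∀ u x, u ++ [x] <+: s → ∀ h : u ≠ [], x ≠ G ⟨u, h⟩

/-- The reduced form of `s x`, for `s` reduced. -/
def reduceSnoc (s : List (E n m)) (x : E n m) : List (E n m) :=
  if ∃ h : s ≠ [], x = G ⟨s, h⟩ then s.dropLast else s ++ [x]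

/-- The reduced form of a word. -/
def reduce (l : List (E n m)) : List (E n m) :=
  l.foldl (reduceSnoc G) []

/-- The value at `α x` of the extension of `G` to all words, where `s` is the reduced form
of `α`. -/
def snocValue (s : List (E n m)) (x : E n m) : E n m :=
  if h : ∃ h : s ≠ [], x = G ⟨s, h⟩ then s.getLast h.1
  else G ⟨s ++ [x], ne_nil_append_singleton s x⟩

/-- The extension to all words of the restriction of `G` to reduced words. -/
def wordExtension (w : Word n m) : E n m :=
  snocValue G (reduce G w.1.dropLast) (w.1.getLast w.2)

variable {G}

theorem Reduced.nil : Reduced G [] := by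
  intro u x h
  simp at h

theorem Reduced.of_prefix {s t : List (E n m)} (ht : Reduced G t) (h : s <+: t) :
    Reduced G s :=
  fun u x hu => ht u x (hu.trans h)

theorem reduced_append_singleton {s : List (E n m)} {x : E n m} :
    Reduced G (s ++ [x]) ↔ Reduced G s ∧ ¬ ∃ h : s ≠ [], x = G ⟨s, h⟩ := by
  constructor
  · intro h
    exact ⟨h.of_prefix (List.prefix_append _ _), fun ⟨hs, hx⟩ => h s x List.prefix_rfl hs hx⟩
  · rintro ⟨hs, hx⟩ u y hu hne hy
    rcases List.prefix_concat_iff.1 hu with h | h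
    · obtain ⟨rfl, h'⟩ := List.append_inj' h rfl
      obtain rfl : y = x := by simpa using h'
      exact hx ⟨hne, hy⟩
    · exact hs u y h hne hy

theorem Reduced.reduceSnoc {s : List (E n m)} (hs : Reduced G s) (x : E n m) :
    Reduced G (reduceSnoc G s x) := by
  unfold _root_.reduceSnoc
  split_ifs with h
  · exact hs.of_prefix (List.dropLast_prefix s)
  · exact reduced_append_singleton.2 ⟨hs, h⟩

theorem reduce_append_singleton (l : List (E n m)) (x : E n m) :
    reduce G (l ++ [x]) = reduceSnoc G (reduce G l) x := by
  simp [reduce]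

theorem reduced_reduce (l : List (E n m)) : Reduced G (reduce G l) := by
  induction l using List.reverseRecOn with
  | nil => exact Reduced.nil
  | append_singleton l x ih =>
    rw [reduce_append_singleton]
    exact ih.reduceSnoc x

theorem Reduced.reduce_eq {l : List (E n m)} (hl : Reduced G l) : reduce G l = l := by
  induction l using List.reverseRecOn with
  | nil => rfl
  | append_singleton l x ih =>
    obtain ⟨h, hx⟩ := reduced_append_singleton.1 hl
    rw [reduce_append_singleton, ih h, _root_.reduceSnoc, if_neg hx]

theorem reduceSnoc_snocValue {s : List (E n m)} (hs : Reduced G s) (x : E n m) :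
    reduceSnoc G (reduceSnoc G s x) (snocValue G s x) = s := by
  by_cases h : ∃ h : s ≠ [], x = G ⟨s, h⟩
  · have hd := s.dropLast_append_getLast h.1
    rw [← hd] at hs
    rw [snocValue, dif_pos h, reduceSnoc.eq_1 G s, if_pos h, reduceSnoc,
      if_neg (reduced_append_singleton.1 hs).2, hd]
  · rw [snocValue, dif_neg h, reduceSnoc.eq_1 G s, if_neg h, reduceSnoc,
      if_pos ⟨ne_nil_append_singleton s x, rfl⟩, List.dropLast_concat]

theorem snocValue_snocValue {s : List (E n m)} (hs : Reduced G s) (x : E n m) :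
    snocValue G (reduceSnoc G s x) (snocValue G s x) = x := by
  by_cases h : ∃ h : s ≠ [], x = G ⟨s, h⟩
  · have hd := s.dropLast_append_getLast h.1
    rw [← hd] at hs
    rw [snocValue.eq_1 G s, dif_pos h, reduceSnoc, if_pos h, snocValue,
      dif_neg (reduced_append_singleton.1 hs).2]
    simp only [hd]
    exact h.2.symm
  · have hv : snocValue G s x = G ⟨s ++ [x], ne_nil_append_singleton s x⟩ := by
      rw [snocValue, dif_neg h]
    have hr : reduceSnoc G s x = s ++ [x] := by rw [reduceSnoc, if_neg h]
    rw [hv, hr, snocValue, dif_pos ⟨ne_nil_append_singleton s x, rfl⟩, List.getLast_concat]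

theorem wordExtension_append_singleton (α : List (E n m)) (e : E n m) :
    wordExtension G ⟨α ++ [e], ne_nil_append_singleton α e⟩ = snocValue G (reduce G α) e := by
  simp [wordExtension]

theorem wordExtension_eq {w : Word n m} (hw : Reduced G w.1) : wordExtension G w = G w := by
  obtain ⟨l, hl⟩ := w
  rcases l.eq_nil_or_concat' with rfl | ⟨s, x, rfl⟩
  · exact absurd rfl hl
  · obtain ⟨hs, hx⟩ := reduced_append_singleton.1 hw
    rw [wordExtension_append_singleton, hs.reduce_eq, snocValue, dif_neg hx]

theorem wordExtension_mem_Zset (hG : G ∈ Zset n m) : wordExtension G ∈ Zset n m := by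
  rintro ⟨l, hl⟩
  rcases l.eq_nil_or_concat' with rfl | ⟨α, x, rfl⟩
  · exact absurd rfl hl
  · rw [wordExtension_append_singleton, snocValue, colorOK]
    simp only [List.getLast_append_singleton]
    split_ifs with h
    · have hc := hG ⟨_, h.1⟩
      rw [colorOK, ← h.2] at hc
      rw [hc, Bool.not_not]
    · have hc := hG ⟨_, ne_nil_append_singleton (reduce G α) x⟩
      simpa [colorOK] using hc

theorem starCond_wordExtension : starCond (wordExtension G) := by
  intro α e
  rw [wordExtension_append_singleton, wordExtension_append_singleton, reduce_append_singleton,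
    snocValue_snocValue (reduced_reduce α)]

theorem starStarCond_wordExtension : starStarCond (wordExtension G) := by
  rintro α e ⟨β, hβ⟩
  have key : reduce G (α ++ [e] ++ [snocValue G (reduce G α) e]) = reduce G α := by
    rw [reduce_append_singleton, reduce_append_singleton,
      reduceSnoc_snocValue (reduced_reduce α)]
  have append_congr (l l' t : List (E n m)) (h : reduce G l = reduce G l') :
      reduce G (l ++ t) = reduce G (l' ++ t) := by
    simpa [reduce] using congrArg (List.foldl (reduceSnoc G) · t) h
  rcases β.eq_nil_or_concat' with rfl | ⟨t, x, rfl⟩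
  · exact absurd rfl hβ
  · simp only [wordExtension_append_singleton, ← List.append_assoc _ t [x]]
    rw [append_congr _ _ t key]

theorem wordExtension_mem_Dset (hG : G ∈ Zset n m) : wordExtension G ∈ Dset n m :=
  ⟨wordExtension_mem_Zset hG, starCond_wordExtension, starStarCond_wordExtension⟩

theorem mem_EOmega_iff {w : Word n m} : w ∈ EOmega G ↔ Reduced G w.1 := by
  constructor
  · obtain ⟨l, hl⟩ := w
    rintro hw u x ⟨t, rfl⟩ hu hx
    refine hw u.length (List.length_pos_iff.2 hu) (by simp) ?_
    simpa using hx
  · intro hw k hk0 hk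
    refine hw (w.1.take k) _ ?_ _
    rw [List.get_eq_getElem, ← List.take_succ_eq_append_getElem hk]
    exact List.take_prefix _ _

end Reduction

/-- Reducedness of a word is the same for two functions which agree on shorter reduced words. -/
theorem Reduced.congr {n m : ℕ} {F G : Word n m → E n m} {s : List (E n m)} (hs : Reduced F s)
    (h : ∀ w : Word n m, Reduced F w.1 → w.1.length ≤ s.length → G w = F w) : Reduced G s := by
  intro u x hu hne
  have hp : u <+: s := (List.prefix_append u [x]).trans hu
  rw [h ⟨u, hne⟩ (hs.of_prefix hp) hp.length_le]
  exact hs u x hu hne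

/-- every partial `E`-function extends to an `E`-function;
consequently, for every partial `E`-function `𝔣` the set
`U_𝔣 = {f ∈ D : f extends 𝔣}` is nonempty, and in particular `D` is nonempty. -/
theorem stmt_7 (n m : ℕ) (hn : 0 < n) (hm : 0 < m) :
    (∀ (r : ℕ) (F : Word n m → E n m), IsPartialEFunction r F →
      ∃ G : Word n m → E n m, IsEFunction G ∧
        ∀ w ∈ EOmega F, w.1.length ≤ r → G w = F w) ∧
    (∀ (r : ℕ) (F : Word n m → E n m), IsPartialEFunction r F →
      ∃ f ∈ Dset n m, ∀ w ∈ EOmega F, w.1.length ≤ r → f w = F w) ∧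
    (Dset n m).Nonempty := by
  have extension (r : ℕ) (F : Word n m → E n m) (hF : IsPartialEFunction r F) :
      ∃ G ∈ Zset n m, ∀ w ∈ EOmega F, w.1.length ≤ r → G w = F w := by
    obtain ⟨G, hG, hGF⟩ := exists_mem_Zset_eq hn hm F
    exact ⟨G, hG, fun w hw hr => hGF w (hF.2 w hw hr)⟩
  refine ⟨fun r F hF => ?_, fun r F hF => ?_, ?_⟩
  · obtain ⟨G, hG, hGF⟩ := extension r F hF
    exact ⟨G, fun w _ => hG w, hGF⟩
  · obtain ⟨G, hG, hGF⟩ := extension r F hF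
    refine ⟨wordExtension G, wordExtension_mem_Dset hG, fun w hw hr => ?_⟩
    rw [wordExtension_eq, hGF w hw hr]
    exact (mem_EOmega_iff.1 hw).congr fun v hv hvw =>
      hGF v (mem_EOmega_iff.2 hv) (hvw.trans hr)
  · obtain ⟨G, hG, -⟩ := exists_mem_Zset_eq hn hm fun _ => Sum.inl ⟨0, hn⟩
    exact ⟨_, wordExtension_mem_Dset hG⟩
end

section
/- The family of sets {U_𝔣 : 𝔣 a partial E-function}, where U_𝔣 = {f ∈ D : f extends 𝔣}, is a basis for the topology of D. -/
theorem starCond.apply_eq {n m : ℕ} {f : Word n m → E n m} (hf : starCond f)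
    (α : List (E n m)) (e x : E n m) (hx : x = f ⟨α ++ [e], ne_nil_append_singleton α e⟩)
    (w : Word n m) (hw : w.1 = (α ++ [e]) ++ [x]) : f w = e := by
  subst hx
  rw [← hf α e]
  exact congrArg f (Subtype.ext hw)

theorem starStarCond.apply_eq {n m : ℕ} {f : Word n m → E n m} (hf : starStarCond f)
    (α : List (E n m)) (e x : E n m) (β : Word n m)
    (hx : x = f ⟨α ++ [e], ne_nil_append_singleton α e⟩)
    (w : Word n m) (hw : w.1 = ((α ++ [e]) ++ [x]) ++ β.1) :
    f w = f ⟨α ++ β.1, ne_nil_append _ β.2⟩ := by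
  subst hx
  rw [← hf α e β]
  exact congrArg f (Subtype.ext hw)

/-- A word outside `Ω(F)` contains a factor `e F(α e)` directly after a prefix `α`. -/
theorem exists_append_of_notMem_EOmega {n m : ℕ} {F : Word n m → E n m} {w : Word n m}
    (hw : w ∉ EOmega F) : ∃ (α : List (E n m)) (e : E n m) (β : List (E n m)),
      w.1 = ((α ++ [e]) ++ [F ⟨α ++ [e], ne_nil_append_singleton α e⟩]) ++ β := by
  simp only [EOmega, Set.mem_ofPred_eq, not_forall, not_not] at hw
  obtain ⟨k, hk0, hk, hF⟩ := hw
  have hne := take_ne_nil w.1 k hk0 w.2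
  have hp := List.dropLast_append_getLast hne
  refine ⟨(w.1.take k).dropLast, (w.1.take k).getLast hne, w.1.drop (k + 1), ?_⟩
  simp only [hp, ← hF]
  simp

/-- Two elements of `D` which agree on the words of `Ω(f)` of length at most `r` agree on all words
of length at most `r`. -/
theorem eq_of_eqOn_EOmega {n m : ℕ} {f g : Word n m → E n m} (hf : f ∈ Dset n m)
    (hg : g ∈ Dset n m) {r : ℕ} (h : ∀ w ∈ EOmega f, w.1.length ≤ r → g w = f w)
    (w : Word n m) (hr : w.1.length ≤ r) : g w = f w := by
  induction hl : w.1.length using Nat.strong_induction_on generalizing w with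
  | _ l ih =>
    by_cases hw : w ∈ EOmega f
    · exact h w hw hr
    obtain ⟨α, e, β, hwe⟩ := exists_append_of_notMem_EOmega hw
    have hlen := congrArg List.length hwe
    simp only [List.length_append, List.length_singleton] at hlen
    have hx : g ⟨α ++ [e], ne_nil_append_singleton α e⟩
        = f ⟨α ++ [e], ne_nil_append_singleton α e⟩ :=
      ih (α ++ [e]).length (by simp; omega) _ (by simp; omega) rfl
    by_cases hβ : β = []
    · subst hβ
      rw [List.append_nil] at hwe
      rw [hf.2.1.apply_eq α e _ rfl w hwe, hg.2.1.apply_eq α e _ hx.symm w hwe]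
    · rw [hf.2.2.apply_eq α e _ ⟨β, hβ⟩ rfl w hwe, hg.2.2.apply_eq α e _ ⟨β, hβ⟩ hx.symm w hwe]
      exact ih (α ++ β).length (by simp; omega) _ (by simp; omega) rfl

theorem finite_setOf_word_length_le (n m r : ℕ) : {w : Word n m | w.1.length ≤ r}.Finite :=
  (List.finite_length_le (E n m) r).preimage Subtype.val_injective.injOn


/-- the family of the sets `U_𝔣 = {f ∈ D : f extends 𝔣}`, as `𝔣`
runs over the partial `E`-functions, is a basis for the topology of `D`. -/
theorem stmt_8 (n m : ℕ) (hn : 0 < n) (hm : 0 < m) :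
    TopologicalSpace.IsTopologicalBasis
      {U : Set ↥(Dset n m) | ∃ (r : ℕ) (F : Word n m → E n m),
        IsPartialEFunction r F ∧
        U = {f : ↥(Dset n m) |
              ∀ w ∈ EOmega F, w.1.length ≤ r → (f : Word n m → E n m) w = F w}} := by
  refine TopologicalSpace.isTopologicalBasis_of_isOpen_of_nhds ?_ ?_
  · rintro U ⟨r, F, -, rfl⟩
    have hU : {f : ↥(Dset n m) |
          ∀ w ∈ EOmega F, w.1.length ≤ r → (f : Word n m → E n m) w = F w}
        = ⋂ w ∈ {w : Word n m | w ∈ EOmega F ∧ w.1.length ≤ r},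
            {f : ↥(Dset n m) | (f : Word n m → E n m) w = F w} := by
      ext f
      simp
    rw [hU]
    refine ((finite_setOf_word_length_le n m r).subset fun w hw => hw.2).isOpen_biInter
      fun w _ => ?_
    have hc : Continuous fun f : ↥(Dset n m) => (f : Word n m → E n m) w :=
      (continuous_apply w).comp continuous_subtype_val
    exact (isOpen_discrete {F w}).preimage hc
  · rintro f V hfV hV
    obtain ⟨W, hW, rfl⟩ := isOpen_induced_iff.mp hV
    obtain ⟨I, u, hu, hIW⟩ := isOpen_pi_iff.mp hW f.1 hfV
    refine ⟨_, ⟨I.sup (fun w => w.1.length) + 1, f.1, ⟨by omega, fun w _ _ => f.2.1 w⟩, rfl⟩,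
      fun w _ _ => rfl, fun g hg => hIW fun w hw => ?_⟩
    have hle : w.1.length ≤ I.sup (fun w => w.1.length) :=
      Finset.le_sup (f := fun w : Word n m => w.1.length) hw
    rw [eq_of_eqOn_EOmega f.2 g.2 hg w (by omega)]
    exact (hu w hw).2
end

section
/- Let r ≥ 1 and let x_1,…,x_r and z_1,…,z_r be generators of F (each equal to some a_i or some b_j) such that z_i ≠ x_i for all i and x_{i+1} ≠ z_i for all i < r (so that g = z_r⁻¹x_r z_{r-1}⁻¹x_{r-1}⋯z_1⁻¹x_1 is in reduced form). If there exists ξ ∈ Ω^u with g⁻¹ ∈ ξ (i.e., the domain of θ^u_g is nonempty), then for every i ∈ {1,…,r} the letters x_i and z_i are of opposite types: one of them is among a_1,…,a_n and the other is among b_1,…,b_m. -/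
/-- The letter `e ∈ E` viewed as a generator of `F` (an `a_i` or a `b_j`). -/
def gen {n m : ℕ} (e : Fin n ⊕ Fin m) : F n m := FreeGroup.of e

/-- The element `g = z_r⁻¹ x_r z_{r-1}⁻¹ x_{r-1} ⋯ z_1⁻¹ x_1` (indices `0`-based). -/
def gWord {n m : ℕ} (r : ℕ) (x z : Fin r → (Fin n ⊕ Fin m)) : F n m :=
  ((List.finRange r).reverse.map (fun i => (gen (z i))⁻¹ * gen (x i))).prod

/-- The word with letters `x i` inverted, then `z i`, for `i` running through `l`. -/
def alternatingWord {ι α : Type*} (x z : ι → α) (l : List ι) : List (α × Bool) :=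
  l.flatMap fun i => [(x i, false), (z i, true)]

theorem mk_alternatingWord {ι α : Type*} (x z : ι → α) (l : List ι) :
    FreeGroup.mk (alternatingWord x z l) =
      (l.map fun i => (FreeGroup.of (x i))⁻¹ * FreeGroup.of (z i)).prod := by
  induction l with
  | nil => rfl
  | cons i l ih =>
    rw [List.map_cons, List.prod_cons, ← ih]
    simp [alternatingWord, FreeGroup.of, FreeGroup.inv_mk, FreeGroup.mul_mk, FreeGroup.invRev]

theorem inv_gWord {n m : ℕ} (r : ℕ) (x z : Fin r → (Fin n ⊕ Fin m)) :
    (gWord r x z)⁻¹ = FreeGroup.mk (alternatingWord x z (List.finRange r)) := by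
  rw [mk_alternatingWord, gWord, List.prod_inv_reverse]
  simp [Function.comp_def, gen, ← List.map_reverse]

theorem isReduced_alternatingWord {ι α : Type*} {x z : ι → α} (hzx : ∀ i, z i ≠ x i) :
    ∀ {l : List ι}, l.IsChain (fun i j => x j ≠ z i) →
      FreeGroup.IsReduced (alternatingWord x z l)
  | [], _ => by simp [alternatingWord]
  | [i], _ => by simp [alternatingWord, FreeGroup.IsReduced, (hzx i).symm]
  | i :: j :: l, h => by
    rw [List.isChain_cons_cons] at h
    have ih := isReduced_alternatingWord hzx h.2
    simp only [alternatingWord, FreeGroup.IsReduced, List.flatMap_cons, List.cons_append,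
      List.nil_append, List.isChain_cons_cons] at ih ⊢
    exact ⟨fun e => absurd e.symm (hzx i), fun e => absurd e.symm h.1, ih⟩

/-- A convex set containing `1` and a reduced word contains every prefix of that word. -/
theorem IsConvexCfgS.mk_prefix_mem {n m : ℕ} {ξ : Set (F n m)} (hξ : IsConvexCfgS ξ)
    (h1 : 1 ∈ ξ) {L₁ L₂ : List ((Fin n ⊕ Fin m) × Bool)}
    (hred : FreeGroup.IsReduced (L₁ ++ L₂)) (hL : FreeGroup.mk (L₁ ++ L₂) ∈ ξ) :
    FreeGroup.mk L₁ ∈ ξ := by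
  have norm_mk : ∀ {L : List ((Fin n ⊕ Fin m) × Bool)}, FreeGroup.IsReduced L →
      (FreeGroup.mk L).norm = L.length := fun h => by
    rw [FreeGroup.norm, FreeGroup.toWord_mk, h.reduce_eq]
  refine hξ 1 h1 _ hL _ ?_
  rw [← FreeGroup.mul_mk, inv_mul_cancel_left, FreeGroup.mul_mk, inv_one, one_mul, one_mul,
    norm_mk hred, norm_mk (hred.infix (List.prefix_append L₁ L₂).isInfix),
    norm_mk (hred.infix (List.suffix_append L₁ L₂).isInfix), List.length_append]

/-- Two distinct outgoing edges at a point of a configuration are of opposite types. -/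
theorem isLeft_eq_not_of_mem {n m : ℕ} {ξ : Set (F n m)} (hξ : ξ ∈ OmegaS n m) {g : F n m}
    (hg : g ∈ ξ) {e f : Fin n ⊕ Fin m} (hne : f ≠ e) (he : g * gen e ∈ ξ) (hf : g * gen f ∈ ξ) :
    e.isLeft = !f.isLeft := by
  rcases hξ.2.2 g hg with ⟨ha, hb, -⟩ | ⟨ha, hb, -⟩
  · rcases e with i | i <;> rcases f with j | j
    · exact absurd (congrArg Sum.inl (ha.unique hf he)) hne
    · rfl
    · rfl
    · exact absurd (congrArg Sum.inr (hb.unique hf he)) hne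
  · rcases e with i | i
    · exact absurd he (ha i)
    · exact absurd he (hb i)

/-- let `g = z_r⁻¹ x_r ⋯ z_1⁻¹ x_1` be in reduced form, where the
`x_i`, `z_i` are generators of `F` with `z_i ≠ x_i` and `x_{i+1} ≠ z_i`.  If the
domain of `θ^u_g` is nonempty, i.e. some `ξ ∈ Ω^u` contains `g⁻¹`, then for each
`i` the letters `x_i` and `z_i` are of opposite types (one is an `a`-generator
and the other a `b`-generator). -/
theorem stmt_11 (n m : ℕ) (hn : 0 < n) (hm : 0 < m)
    (r : ℕ) (hr : 1 ≤ r) (x z : Fin r → (Fin n ⊕ Fin m))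
    (hzx : ∀ i : Fin r, z i ≠ x i)
    (hxz : ∀ (i : ℕ) (h1 : i + 1 < r), x ⟨i + 1, h1⟩ ≠ z ⟨i, by omega⟩)
    (hdom : ∃ ξ ∈ OmegaS n m, (gWord r x z)⁻¹ ∈ ξ) :
    ∀ i : Fin r, (x i).isLeft = !(z i).isLeft := by
  obtain ⟨ξ, hξ, hg⟩ := hdom
  rw [inv_gWord] at hg
  have hred : FreeGroup.IsReduced (alternatingWord x z (List.finRange r)) := by
    refine isReduced_alternatingWord hzx (List.isChain_iff_getElem.2 fun i h => ?_)
    simpa using hxz i (by simpa using h)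
  intro i
  obtain ⟨l₁, l₂, hl⟩ := List.append_of_mem (List.mem_finRange i)
  rw [hl] at hg hred
  simp only [alternatingWord, List.flatMap_append, List.flatMap_cons] at hg hred
  set L₁ := l₁.flatMap fun i => [(x i, false), (z i, true)]
  set L₂ := l₂.flatMap fun i => [(x i, false), (z i, true)]
  have mem_of_prefix : ∀ {P S}, L₁ ++ ([(x i, false), (z i, true)] ++ L₂) = P ++ S →
      FreeGroup.mk P ∈ ξ := fun h => hξ.2.1.mk_prefix_mem hξ.1 (h ▸ hred) (h ▸ hg)
  have h₀ : FreeGroup.mk L₁ ∈ ξ := mem_of_prefix rfl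
  have h₁ : FreeGroup.mk (L₁ ++ [(x i, false)]) ∈ ξ :=
    mem_of_prefix (S := (z i, true) :: L₂) (by simp)
  have h₂ : FreeGroup.mk (L₁ ++ [(x i, false)] ++ [(z i, true)]) ∈ ξ :=
    mem_of_prefix (S := L₂) (by simp)
  refine isLeft_eq_not_of_mem hξ h₁ (hzx i) ?_ ?_
  · have : FreeGroup.mk [(x i, false)] = (gen (x i))⁻¹ := rfl
    rwa [← FreeGroup.mul_mk, this, inv_mul_cancel_right]
  · rwa [← FreeGroup.mul_mk] at h₂
end

section
/- If m, n ≥ 2, then the partial action θ^u of F on Ω^u is topologically free: for every g ∈ F with g ≠ 1, the set {ξ ∈ Ω^u : g⁻¹ ∈ ξ and gξ = ξ} of fixed points of θ^u_g has empty interior in Ω^u. -/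
namespace FreeGroup

variable {α : Type*} [DecidableEq α]

/-- The elements of the free group whose reduced word begins with a letter in `P`. -/
def cone (P : Set (α × Bool)) : Set (FreeGroup α) :=
  {x | ∃ w ∈ P, x.toWord.head? = some w}

theorem one_notMem_cone (P : Set (α × Bool)) : (1 : FreeGroup α) ∉ cone P := by
  simp [cone]

theorem norm_pos_of_mem_cone {P : Set (α × Bool)} {x : FreeGroup α} (hx : x ∈ cone P) :
    0 < x.norm := by
  rw [Nat.pos_iff_ne_zero, Ne, norm_eq_zero]
  rintro rfl
  exact one_notMem_cone P hx

theorem of_mem_cone {P : Set (α × Bool)} {p : α} : of p ∈ cone P ↔ (p, true) ∈ P := by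
  simp [cone]

theorem inv_of_mem_cone {P : Set (α × Bool)} {p : α} : (of p)⁻¹ ∈ cone P ↔ (p, false) ∈ P := by
  simp [cone, toWord_inv, invRev]

theorem norm_inv_mul_of_mem_cone {P : Set (α × Bool)} {x y : FreeGroup α} (hx : x ∉ cone P)
    (hy : y ∈ cone P) : (x⁻¹ * y).norm = x.norm + y.norm := by
  have hred : IsReduced (x⁻¹.toWord ++ y.toWord) := by
    refine List.isChain_append.2 ⟨isReduced_toWord, isReduced_toWord, ?_⟩
    intro u hu w hw huw
    obtain ⟨w', hwP, hw'⟩ := hy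
    obtain rfl : w' = w := by
      rw [hw'] at hw
      simpa using hw
    by_contra hne
    refine hx ⟨w', hwP, ?_⟩
    rw [toWord_inv] at hu
    simp only [invRev, List.getLast?_reverse, List.head?_map, Option.mem_def,
      Option.map_eq_some_iff] at hu
    obtain ⟨t, ht, rfl⟩ := hu
    rw [ht, Option.some_inj]
    refine Prod.ext huw ?_
    revert hne
    cases t.2 <;> cases w'.2 <;> simp
  rw [norm, toWord_mul, hred.reduce_eq, List.length_append]
  simp only [← norm.eq_1, norm_inv_eq]

theorem norm_mul_of_mem_cone {P : Set (α × Bool)} {x y : FreeGroup α} (hx : x⁻¹ ∉ cone P)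
    (hy : y ∈ cone P) : (x * y).norm = x.norm + y.norm := by
  simpa using norm_inv_mul_of_mem_cone hx hy

theorem mul_mem_cone_or_eq_one {P : Set (α × Bool)} {x s : FreeGroup α} (hx : x ∈ cone P)
    (hs : s.norm = 1) : x * s ∈ cone P ∨ x * s = 1 := by
  by_contra! h
  have h1 := norm_inv_mul_of_mem_cone h.1 hx
  rw [show (x * s)⁻¹ * x = s⁻¹ by group, norm_inv_eq, hs] at h1
  have h2 := norm_pos_of_mem_cone hx
  exact h.2 (norm_eq_zero.1 (by omega))

theorem norm_inv_of_mul_of_mem_cone {p : α} {x : FreeGroup α} (hx : x ∈ cone {(p, true)}) :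
    1 + ((of p)⁻¹ * x).norm = x.norm := by
  obtain ⟨w, rfl, hw⟩ := hx
  obtain ⟨t, ht⟩ : ∃ t, x.toWord = (p, true) :: t := by
    cases h : x.toWord with
    | nil => simp [h] at hw
    | cons c t => exact ⟨t, by simp_all⟩
  have hxe : x = of p * mk t := by
    rw [← mk_toWord (x := x), ht]
    rfl
  have hle : (mk t : FreeGroup α).norm ≤ t.length := norm_mk_le
  have hge := norm_mul_le (of p) (mk t)
  rw [← hxe] at hge
  have hx' : x.norm = t.length + 1 := by rw [norm, ht, List.length_cons]
  rw [show (of p)⁻¹ * x = mk t by rw [hxe]; group]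
  rw [norm_of] at hge
  omega

theorem toWord_freeGroupCongr (e : Equiv.Perm α) (x : FreeGroup α) :
    (freeGroupCongr e x).toWord = x.toWord.map fun w => (e w.1, w.2) := by
  have hred : IsReduced (x.toWord.map fun w => (e w.1, w.2)) := by
    refine (List.isChain_map _).2 ?_
    refine List.IsChain.imp ?_ (isReduced_toWord (x := x))
    intro u w h huw
    exact h (e.injective huw)
  rw [← hred.reduce_eq, ← toWord_mk]
  congr 1
  conv_lhs => rw [← mk_toWord (x := x)]
  simp

theorem norm_freeGroupCongr (e : Equiv.Perm α) (x : FreeGroup α) :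
    (freeGroupCongr e x).norm = x.norm := by
  rw [norm, toWord_freeGroupCongr, List.length_map, norm]

theorem freeGroupCongr_mem_cone {e : Equiv.Perm α} {P Q : Set (α × Bool)}
    (h : ∀ w ∈ P, (e w.1, w.2) ∈ Q) {x : FreeGroup α} (hx : x ∈ cone P) :
    freeGroupCongr e x ∈ cone Q := by
  obtain ⟨w, hw, hxw⟩ := hx
  exact ⟨_, h w hw, by rw [toWord_freeGroupCongr, List.head?_map, hxw]; rfl⟩

/-- The elements whose reduced word begins with `p` or with `q`. -/
abbrev pairCone (p q : α) : Set (FreeGroup α) := cone {(p, true), (q, true)}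

theorem swap_mem_pairCone {p q : α} {x : FreeGroup α} (hx : x ∈ pairCone p q) :
    freeGroupCongr (Equiv.swap p q) x ∈ pairCone p q := by
  refine freeGroupCongr_mem_cone ?_ hx
  rintro w (rfl | rfl) <;> simp

open Classical in
/-- The automorphism of the Cayley tree that exchanges the branches at `1` in the directions `p`
and `q` and fixes all the other branches. -/
noncomputable def branchSwap (p q : α) (x : FreeGroup α) : FreeGroup α :=
  if x ∈ pairCone p q then freeGroupCongr (Equiv.swap p q) x else x

theorem branchSwap_of_mem {p q : α} {x : FreeGroup α} (hx : x ∈ pairCone p q) :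
    branchSwap p q x = freeGroupCongr (Equiv.swap p q) x := if_pos hx

theorem branchSwap_of_notMem {p q : α} {x : FreeGroup α} (hx : x ∉ pairCone p q) :
    branchSwap p q x = x := if_neg hx

theorem norm_branchSwap_inv_mul (p q : α) (x y : FreeGroup α) :
    ((branchSwap p q x)⁻¹ * branchSwap p q y).norm = (x⁻¹ * y).norm := by
  have key : ∀ x y : FreeGroup α, x ∉ pairCone p q → y ∈ pairCone p q →
      ((branchSwap p q x)⁻¹ * branchSwap p q y).norm = (x⁻¹ * y).norm := by
    intro x y hx hy
    rw [branchSwap_of_mem hy, branchSwap_of_notMem hx,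
      norm_inv_mul_of_mem_cone hx (swap_mem_pairCone hy), norm_inv_mul_of_mem_cone hx hy,
      norm_freeGroupCongr]
  by_cases hx : x ∈ pairCone p q <;> by_cases hy : y ∈ pairCone p q
  · rw [branchSwap_of_mem hx, branchSwap_of_mem hy, ← _root_.map_inv, ← _root_.map_mul,
      norm_freeGroupCongr]
  · rw [← norm_inv_eq, ← norm_inv_eq (x := x⁻¹ * y)]
    simpa only [mul_inv_rev, inv_inv] using key y x hy hx
  · exact key x y hx hy
  · rw [branchSwap_of_notMem hx, branchSwap_of_notMem hy]

theorem branchSwap_mul_of_mem {p q : α} {x s : FreeGroup α} (hx : x ∈ pairCone p q)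
    (hs : s.norm = 1) :
    branchSwap p q (x * s) = branchSwap p q x * freeGroupCongr (Equiv.swap p q) s := by
  rw [branchSwap_of_mem hx, ← _root_.map_mul]
  rcases mul_mem_cone_or_eq_one hx hs with h | h
  · exact branchSwap_of_mem h
  · rw [h, _root_.map_one, branchSwap_of_notMem (one_notMem_cone _)]

theorem branchSwap_mul_of_notMem {p q : α} {x s : FreeGroup α} (hx : x ∉ pairCone p q)
    (hx1 : x ≠ 1) (hs : s.norm = 1) :
    branchSwap p q (x * s) = branchSwap p q x * s := by
  rw [branchSwap_of_notMem hx]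
  refine branchSwap_of_notMem fun h => ?_
  have := mul_mem_cone_or_eq_one h (s := s⁻¹) (by rwa [norm_inv_eq])
  simp_all

theorem branchSwap_one (p q : α) : branchSwap p q 1 = 1 :=
  branchSwap_of_notMem (one_notMem_cone _)

theorem branchSwap_of (p q s : α) : branchSwap p q (of s) = of (Equiv.swap p q s) := by
  by_cases h : of s ∈ pairCone p q
  · rw [branchSwap_of_mem h]
    simp
  · rw [branchSwap_of_notMem h, Equiv.swap_apply_of_ne_of_ne]
    · rintro rfl
      exact h (of_mem_cone.2 (by simp))
    · rintro rfl
      exact h (of_mem_cone.2 (by simp))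

theorem branchSwap_inv_of (p q s : α) : branchSwap p q (of s)⁻¹ = (of s)⁻¹ :=
  branchSwap_of_notMem fun h => by simpa using inv_of_mem_cone.1 h

theorem finite_norm_le [Finite α] (C : ℕ) : {x : FreeGroup α | x.norm ≤ C}.Finite :=
  Set.Finite.of_finite_image
    ((List.finite_length_le (α × Bool) C).subset (by rintro _ ⟨x, hx, rfl⟩; exact hx))
    toWord_injective.injOn

theorem exists_lt_norm_mul_pow [Finite α] {g : FreeGroup α} (hg : g ≠ 1) (v : FreeGroup α)
    (C : ℕ) : ∃ N : ℕ, C < (v * g ^ N).norm := by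
  by_contra! h
  have hinj : Function.Injective fun N : ℕ => v * g ^ N := fun M N hMN =>
    IsMulTorsionFree.pow_right_injective hg (mul_left_cancel hMN)
  exact Set.infinite_of_injective_forall_mem hinj h (finite_norm_le C)

end FreeGroup

open FreeGroup

section Configurations

variable {n m : ℕ} {ξ : F n m → Bool}

/-- If the letters at `g` in `η` correspond to the letters at `k` in `ξ` via permutations of the
generators, then a pattern of `ξ` at `k` gives a pattern of `η` at `g`. -/
theorem pattern_of_letters_perm {η : F n m → Bool} {g k : F n m} (e₁ : Equiv.Perm (Fin n))
    (e₂ : Equiv.Perm (Fin m)) (f₁ : Fin n → Fin n) (f₂ : Fin m → Fin m)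
    (ha : ∀ i, η (g * a i) = ξ (k * a (e₁ i))) (hb : ∀ j, η (g * b j) = ξ (k * b (e₂ j)))
    (ha' : ∀ i, η (g * (a i)⁻¹) = ξ (k * (a (f₁ i))⁻¹))
    (hb' : ∀ j, η (g * (b j)⁻¹) = ξ (k * (b (f₂ j))⁻¹))
    (h : PatternC1 ξ k ∨ PatternC2 ξ k) : PatternC1 η g ∨ PatternC2 η g := by
  refine h.imp ?_ ?_
  · rintro ⟨h1, h2, h3, h4⟩
    simp only [PatternC1, ha, hb, ha', hb']
    exact ⟨(e₁.existsUnique_congr_left (p := fun i => ξ (k * a (e₁ i)) = true)).2 (by simpa),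
      (e₂.existsUnique_congr_left (p := fun j => ξ (k * b (e₂ j)) = true)).2 (by simpa),
      fun _ => h3 _, fun _ => h4 _⟩
  · rintro ⟨h1, h2, h3, h4⟩
    simp only [PatternC2, ha, hb, ha', hb']
    exact ⟨fun _ => h1 _, fun _ => h2 _, fun _ => h3 _, fun _ => h4 _⟩

/-- The image of `ξ` under the exchange of the branches at `v` in the directions `p` and `q`. -/
noncomputable def swapAt (v : F n m) (p q : Fin n ⊕ Fin m) (ξ : F n m → Bool) : F n m → Bool :=
  fun x => ξ (v * branchSwap p q (v⁻¹ * x))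

theorem IsConvexCfg.swapAt (hξ : IsConvexCfg ξ) (v : F n m) (p q : Fin n ⊕ Fin m) :
    IsConvexCfg (swapAt v p q ξ) := by
  intro g h k hg hh hk
  refine hξ _ _ _ hg hh ?_
  have key : ∀ x y : F n m, ((v * branchSwap p q (v⁻¹ * x))⁻¹ *
      (v * branchSwap p q (v⁻¹ * y))).norm = (x⁻¹ * y).norm := by
    intro x y
    have := norm_branchSwap_inv_mul p q (v⁻¹ * x) (v⁻¹ * y)
    simpa [mul_assoc] using this
  rw [key, key, key, hk]

theorem swapAt_mem_Omega (hξ : ξ ∈ Omega n m) {v : F n m} {p q : Fin n ⊕ Fin m}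
    (hv : v⁻¹ ∉ pairCone p q) {e₁ : Equiv.Perm (Fin n)} {e₂ : Equiv.Perm (Fin m)}
    (he : Equiv.swap p q = Equiv.sumCongr e₁ e₂) : swapAt v p q ξ ∈ Omega n m := by
  have hnorm : ∀ s : Fin n ⊕ Fin m, (of s)⁻¹.norm = 1 := fun s => by rw [norm_inv_eq, norm_of]
  refine ⟨?_, hξ.2.1.swapAt v p q, fun g hg => ?_⟩
  · simpa [swapAt, branchSwap_of_notMem hv] using hξ.1
  have hpat := hξ.2.2 _ hg
  by_cases h1 : v⁻¹ * g = 1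
  · rw [h1, branchSwap_one, mul_one] at hpat
    refine pattern_of_letters_perm e₁ e₂ id id ?_ ?_ ?_ ?_ hpat <;> intro i <;>
      simp only [swapAt, a, b, ← mul_assoc, h1, one_mul, branchSwap_of, branchSwap_inv_of, he, id,
        Equiv.sumCongr_apply, Sum.map_inl, Sum.map_inr]
  by_cases h2 : v⁻¹ * g ∈ pairCone p q
  · refine pattern_of_letters_perm e₁ e₂ e₁ e₂ ?_ ?_ ?_ ?_ hpat <;> intro i <;>
      simp only [swapAt, a, b, ← mul_assoc v⁻¹, branchSwap_mul_of_mem h2 (norm_of _),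
        branchSwap_mul_of_mem h2 (hnorm _)] <;>
      simp [he, mul_assoc]
  · refine pattern_of_letters_perm 1 1 id id ?_ ?_ ?_ ?_ hpat <;> intro i <;>
      simp only [swapAt, a, b, ← mul_assoc v⁻¹, branchSwap_mul_of_notMem h2 h1 (norm_of _),
        branchSwap_mul_of_notMem h2 h1 (hnorm _)] <;>
      simp [mul_assoc]

theorem IsConvexCfg.of_mem_cone (hξ : IsConvexCfg ξ) {v x : F n m} {p : Fin n ⊕ Fin m}
    (hv : ξ v = true) (hx : ξ (v * x) = true) (hp : x ∈ cone {(p, true)}) :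
    ξ (v * of p) = true := by
  refine hξ v (v * x) _ hv hx ?_
  have := norm_inv_of_mul_of_mem_cone hp
  simpa [mul_assoc] using this

/-- A reduced word does not begin with two different letters. -/
theorem notMem_cone_or_notMem_cone {P Q : Set ((Fin n ⊕ Fin m) × Bool)} (hPQ : Disjoint P Q)
    (x : F n m) : x ∉ cone P ∨ x ∉ cone Q := by
  by_contra! h
  obtain ⟨⟨u, hu, hxu⟩, w, hw, hxw⟩ := h
  obtain rfl : u = w := by simpa [hxu] using hxw
  exact Set.disjoint_left.1 hPQ hu hw

theorem exists_norm_succ [NeZero n] [NeZero m] (hξ : ξ ∈ Omega n m) {w : F n m}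
    (hw : ξ w = true) :
    ∃ w', ξ w' = true ∧ w'.norm = w.norm + 1 ∧ (PatternC1 ξ w ∨ PatternC1 ξ w') := by
  rcases hξ.2.2 w hw with h | h
  · obtain ⟨i, hi, -⟩ := h.1
    obtain ⟨j, hj, -⟩ := h.2.1
    rcases notMem_cone_or_notMem_cone (P := {(Sum.inl i, true)}) (Q := {(Sum.inr j, true)})
      (by simp) w⁻¹ with hc | hc
    · exact ⟨_, hi, by rw [a, norm_mul_of_mem_cone hc (of_mem_cone.2 rfl), norm_of], .inl h⟩
    · exact ⟨_, hj, by rw [b, norm_mul_of_mem_cone hc (of_mem_cone.2 rfl), norm_of], .inl h⟩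
  · have hn : ∀ s : Fin n ⊕ Fin m, (of s)⁻¹.norm = 1 := fun s => by rw [norm_inv_eq, norm_of]
    rcases notMem_cone_or_notMem_cone (P := {(Sum.inl 0, false)}) (Q := {(Sum.inr 0, false)})
      (by simp) w⁻¹ with hc | hc
    · refine ⟨_, h.2.2.1 0, by rw [a, norm_mul_of_mem_cone hc (inv_of_mem_cone.2 rfl), hn], .inr ?_⟩
      refine (hξ.2.2 _ (h.2.2.1 0)).resolve_right fun h2 => ?_
      simpa [hw] using h2.1 0
    · refine ⟨_, h.2.2.2 0, by rw [b, norm_mul_of_mem_cone hc (inv_of_mem_cone.2 rfl), hn], .inr ?_⟩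
      refine (hξ.2.2 _ (h.2.2.2 0)).resolve_right fun h2 => ?_
      simpa [hw] using h2.2.1 0

theorem exists_patternC1_le_norm [NeZero n] [NeZero m] (hξ : ξ ∈ Omega n m) (L : ℕ) :
    ∃ v, ξ v = true ∧ L ≤ v.norm ∧ PatternC1 ξ v := by
  have hfar : ∃ w, ξ w = true ∧ L ≤ w.norm := by
    induction L with
    | zero => exact ⟨1, hξ.1, Nat.zero_le _⟩
    | succ L ih =>
      obtain ⟨w, hw, hL⟩ := ih
      obtain ⟨w', hw', hn, -⟩ := exists_norm_succ hξ hw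
      exact ⟨w', hw', by omega⟩
  obtain ⟨w, hw, hL⟩ := hfar
  obtain ⟨w', hw', hn, h | h⟩ := exists_norm_succ hξ hw
  · exact ⟨w, hw, hL, h⟩
  · exact ⟨w', hw', by omega, h⟩

theorem PatternC1.exists_swap (hn : 2 ≤ n) (hm : 2 ≤ m) {v : F n m} (h : PatternC1 ξ v) :
    ∃ (p q : Fin n ⊕ Fin m) (e₁ : Equiv.Perm (Fin n)) (e₂ : Equiv.Perm (Fin m)),
      Equiv.swap p q = Equiv.sumCongr e₁ e₂ ∧ ξ (v * of p) = true ∧ ξ (v * of q) = false ∧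
      v⁻¹ ∉ pairCone p q := by
  have : Nontrivial (Fin n) := Fin.nontrivial_iff_two_le.2 hn
  have : Nontrivial (Fin m) := Fin.nontrivial_iff_two_le.2 hm
  obtain ⟨i, hi, hi'⟩ := h.1
  obtain ⟨j, hj, hj'⟩ := h.2.1
  obtain ⟨i₂, hi₂⟩ := exists_ne i
  obtain ⟨j₂, hj₂⟩ := exists_ne j
  rcases notMem_cone_or_notMem_cone (P := {(Sum.inl i, true), (Sum.inl i₂, true)})
    (Q := {(Sum.inr j, true), (Sum.inr j₂, true)}) (by simp) v⁻¹ with hc | hc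
  · exact ⟨.inl i, .inl i₂, Equiv.swap i i₂, 1, (Equiv.Perm.sumCongr_swap_one i i₂).symm, hi,
      by_contra fun hne => hi₂ (hi' _ (eq_true_of_ne_false hne)), hc⟩
  · exact ⟨.inr j, .inr j₂, 1, Equiv.swap j j₂, (Equiv.Perm.sumCongr_one_swap j j₂).symm, hj,
      by_contra fun hne => hj₂ (hj' _ (eq_true_of_ne_false hne)), hc⟩

theorem apply_pow_mul_of_transl_eq {g : F n m} (h : transl g ξ = ξ) (N : ℕ) (x : F n m) :
    ξ (g ^ N * x) = ξ x := by
  induction N with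
  | zero => simp
  | succ N ih =>
    rw [← ih, pow_succ', mul_assoc]
    conv_lhs => rw [← h]
    simp [transl]

theorem transl_swapAt_ne (hξ : ξ ∈ Omega n m) {g : F n m} (hg : g ≠ 1) (hfix : transl g ξ = ξ)
    {v : F n m} {p q : Fin n ⊕ Fin m} (hv : ξ v = true) (hp : ξ (v * of p) = true)
    (hq : ξ (v * of q) = false) (hη : swapAt v p q ξ ∈ Omega n m) :
    transl g (swapAt v p q ξ) ≠ swapAt v p q ξ := by
  intro hfix'
  have hdisj : ∀ x, v⁻¹ * x ∈ pairCone p q → ξ x = true → swapAt v p q ξ x = true → False := by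
    intro x hx h1 h2
    have hmem : v⁻¹ * x ∈ cone {(p, true)} ∨ v⁻¹ * x ∈ cone {(q, true)} := by
      obtain ⟨w, rfl | rfl, hw⟩ := hx
      · exact .inl ⟨_, rfl, hw⟩
      · exact .inr ⟨_, rfl, hw⟩
    rcases hmem with h | h
    · rw [swapAt, branchSwap_of_mem hx] at h2
      have := hξ.2.1.of_mem_cone hv h2 (freeGroupCongr_mem_cone (Q := {(q, true)}) (by simp) h)
      simp [hq] at this
    · have := hξ.2.1.of_mem_cone hv (x := v⁻¹ * x) (by simpa using h1) h
      simp [hq] at this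
  obtain ⟨N, hN⟩ := exists_lt_norm_mul_pow hg v⁻¹ (v * of p).norm
  have hout : v⁻¹ * g ^ N ∉ pairCone p q := fun h => by
    refine hdisj _ h ?_ ?_
    · simpa [hξ.1] using apply_pow_mul_of_transl_eq hfix N 1
    · simpa [hη.1] using apply_pow_mul_of_transl_eq hfix' N 1
  have hin : v⁻¹ * (g ^ N * (v * of p)) ∈ pairCone p q := by
    by_contra h
    have h1 := apply_pow_mul_of_transl_eq hfix' N (v * of p)
    have h2 : swapAt v p q ξ (v * of p) = false := by
      simpa [swapAt, branchSwap_of] using hq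
    rw [h2, swapAt, branchSwap_of_notMem h, mul_inv_cancel_left,
      apply_pow_mul_of_transl_eq hfix, hp] at h1
    simp at h1
  have hsum := norm_inv_mul_of_mem_cone hout hin
  rw [show (v⁻¹ * g ^ N)⁻¹ * (v⁻¹ * (g ^ N * (v * of p))) = v * of p by group] at hsum
  omega

theorem exists_agreeing_not_fixed (hn : 2 ≤ n) (hm : 2 ≤ m) (hξ : ξ ∈ Omega n m) {g : F n m}
    (hg : g ≠ 1) (hfix : transl g ξ = ξ) (I : Finset (F n m)) :
    ∃ η ∈ Omega n m, (∀ x ∈ I, η x = ξ x) ∧ transl g η ≠ η := by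
  have : NeZero n := ⟨by omega⟩
  have : NeZero m := ⟨by omega⟩
  obtain ⟨v, hv, hL, hC⟩ := exists_patternC1_le_norm hξ (I.sup FreeGroup.norm)
  obtain ⟨p, q, e₁, e₂, he, hp, hq, hvc⟩ := hC.exists_swap hn hm
  have hη := swapAt_mem_Omega hξ hvc he
  refine ⟨_, hη, fun x hx => ?_, transl_swapAt_ne hξ hg hfix hv hp hq hη⟩
  have hnot : v⁻¹ * x ∉ pairCone p q := fun h => by
    have h1 := norm_mul_of_mem_cone hvc h
    have h2 := norm_pos_of_mem_cone h
    have h3 : x.norm ≤ I.sup FreeGroup.norm := Finset.le_sup hx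
    rw [mul_inv_cancel_left] at h1
    omega
  rw [swapAt, branchSwap_of_notMem hnot, mul_inv_cancel_left]

end Configurations

/-- if `m, n ≥ 2`, the partial action `θ^u` of `F` on `Ω^u` is
topologically free: for every `g ≠ 1`, the fixed-point set
`{ξ ∈ Ω^u : g⁻¹ ∈ ξ and gξ = ξ}` of `θ^u_g` has empty interior in `Ω^u`. -/
theorem stmt_12 (n m : ℕ) (hm : 2 ≤ m) (hn : 2 ≤ n) (g : F n m) (hg : g ≠ 1) :
    interior {ξ : ↥(Omega n m) |
      (ξ : F n m → Bool) g⁻¹ = true ∧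
      transl g (ξ : F n m → Bool) = (ξ : F n m → Bool)} = ∅ := by
  rw [Set.eq_empty_iff_forall_notMem]
  intro ξ hξ
  obtain ⟨U, hU, hUo, hξU⟩ := mem_interior.1 hξ
  obtain ⟨V, hVo, rfl⟩ := isOpen_induced_iff.1 hUo
  obtain ⟨I, u, hu, hIV⟩ := isOpen_pi_iff.1 hVo _ hξU
  obtain ⟨η, hη, hagree, hne⟩ := exists_agreeing_not_fixed hn hm ξ.2 hg (hU hξU).2 I
  refine hne (hU (a := ⟨η, hη⟩) (hIV fun x hx => ?_)).2
  change η x ∈ u x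
  rw [hagree x hx]
  exact (hu x hx).2
end

section
/- Let G be a group, let F_2 be the free group on two generators c_1, c_2, and let φ : G → F_2 be a group homomorphism. Suppose x, y ∈ G and p, q ≥ 1 are integers such that φ(x) = c_1^p and φ(y) = c_2^q. Then the subgroup of G generated by {x, y} is isomorphic to the free group on two generators. -/
/-- Replacing each letter of a reduced word by a positive power of itself leaves it reduced. -/
theorem FreeGroup.IsReduced.flatMap_replicate {α : Type*} {n : α → ℕ} (hn : ∀ i, n i ≠ 0)
    {L : List (α × Bool)} (hL : FreeGroup.IsReduced L) :
    FreeGroup.IsReduced (L.flatMap fun a => List.replicate (n a.1) a) := by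
  unfold FreeGroup.IsReduced at hL ⊢
  rw [List.flatMap_def, List.isChain_flatten (by simp [hn])]
  refine ⟨?_, ?_⟩
  · intro l hl
    obtain ⟨a, -, rfl⟩ := List.mem_map.1 hl
    exact List.isChain_replicate_of_rel _ fun _ => rfl
  · rw [List.isChain_map]
    refine hL.imp fun a b hab => ?_
    simpa [List.getLast?_replicate, List.head?_replicate, hn] using hab

theorem FreeGroup.lift_of_pow_mk {α : Type*} (n : α → ℕ) (L : List (α × Bool)) :
    FreeGroup.lift (fun i => FreeGroup.of i ^ n i) (FreeGroup.mk L) =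
      FreeGroup.mk (L.flatMap fun a => List.replicate (n a.1) a) := by
  have mk_pow (a : α × Bool) (k : ℕ) :
      FreeGroup.mk (List.replicate k a) = FreeGroup.mk [a] ^ k := by
    simp [FreeGroup.pow_mk]
  induction L with
  | nil => simp [← FreeGroup.one_eq_mk]
  | cons a L ih =>
    rw [← List.singleton_append, ← FreeGroup.mul_mk, _root_.map_mul, ih, List.flatMap_append,
      ← FreeGroup.mul_mk]
    congr 1
    obtain ⟨i, b⟩ := a
    rw [List.flatMap_singleton, mk_pow]
    cases b <;> simp [FreeGroup.of, FreeGroup.invRev]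

/-- Positive powers of the generators of a free group freely generate a subgroup. -/
theorem FreeGroup.lift_of_pow_injective {α : Type*} {n : α → ℕ} (hn : ∀ i, n i ≠ 0) :
    Function.Injective (FreeGroup.lift fun i => FreeGroup.of i ^ n i) := by
  classical
  rw [injective_iff_map_eq_one]
  intro w hw
  rw [← FreeGroup.mk_toWord (x := w), FreeGroup.lift_of_pow_mk] at hw
  have h := congrArg FreeGroup.toWord hw
  rw [FreeGroup.toWord_mk,
    (FreeGroup.isReduced_toWord.flatMap_replicate hn).reduce_eq, FreeGroup.toWord_one,
    List.flatMap_eq_nil_iff] at h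
  refine FreeGroup.toWord_eq_nil_iff.1 (List.eq_nil_iff_forall_not_mem.2 fun a ha => ?_)
  exact hn a.1 (by simpa using h a ha)

/-- let `G` be a group, `F_2` the free group on two generators
`c_1, c_2`, and `φ : G → F_2` a group homomorphism.  If `x, y ∈ G` and
`p, q ≥ 1` satisfy `φ(x) = c_1^p` and `φ(y) = c_2^q`, then the subgroup of `G`
generated by `{x, y}` is isomorphic to the free group on two generators. -/
theorem stmt_14 (G : Type*) [Group G] (φ : G →* FreeGroup (Fin 2))
    (x y : G) (p q : ℕ) (hp : 1 ≤ p) (hq : 1 ≤ q)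
    (hx : φ x = (FreeGroup.of (0 : Fin 2)) ^ p)
    (hy : φ y = (FreeGroup.of (1 : Fin 2)) ^ q) :
    Nonempty ((Subgroup.closure ({x, y} : Set G)) ≃* FreeGroup (Fin 2)) := by
  have hinj : Function.Injective (FreeGroup.lift ![x, y]) := by
    have hn : ∀ i, ![p, q] i ≠ 0 := by
      intro i
      fin_cases i <;> simp <;> omega
    have hcomp : φ.comp (FreeGroup.lift ![x, y]) =
        FreeGroup.lift fun i => FreeGroup.of i ^ ![p, q] i := by
      ext i
      fin_cases i <;> simp [hx, hy]
    have h := FreeGroup.lift_of_pow_injective hn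
    rw [← hcomp, MonoidHom.coe_comp] at h
    exact h.of_comp
  have hrange : (FreeGroup.lift ![x, y]).range = Subgroup.closure {x, y} := by
    rw [FreeGroup.range_lift_eq_closure, Matrix.range_cons_cons_empty]
  exact ⟨((MonoidHom.ofInjective hinj).trans (MulEquiv.subgroupCongr hrange)).symm⟩
end

section
/- Assume m, n ≥ 2. Let Z ⊆ Ω^u be a finite subset that is invariant under the partial action θ^u, meaning: for every g ∈ F and every ξ ∈ Z with g⁻¹ ∈ ξ, one has gξ ∈ Z. Then for every ξ ∈ Z, the isotropy set F^ξ = {g ∈ F : g⁻¹ ∈ ξ and gξ = ξ} is a subgroup of F, and it contains a subgroup isomorphic to the free group on two generators. -/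
theorem transS_one {n m : ℕ} (ξ : Set (F n m)) : transS 1 ξ = ξ := by
  simp [transS]

theorem transS_mul {n m : ℕ} (g h : F n m) (ξ : Set (F n m)) :
    transS (g * h) ξ = transS g (transS h ξ) := by
  simp only [transS, Set.image_image, mul_assoc]

/-- The stabilizer of a configuration under left translation. -/
def translationStabilizer {n m : ℕ} (ξ : Set (F n m)) : Subgroup (F n m) where
  carrier := {g | transS g ξ = ξ}
  one_mem' := transS_one ξ
  mul_mem' {x y} (hx : transS x ξ = ξ) (hy : transS y ξ = ξ) :=
    show transS (x * y) ξ = ξ by rw [transS_mul, hy, hx]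
  inv_mem' {x} (hx : transS x ξ = ξ) :=
    show transS x⁻¹ ξ = ξ by rw [← hx, ← transS_mul, inv_mul_cancel, transS_one, hx]

theorem mem_translationStabilizer {n m : ℕ} {ξ : Set (F n m)} {g : F n m} :
    g ∈ translationStabilizer ξ ↔ transS g ξ = ξ := Iff.rfl

theorem inv_mem_of_mem_translationStabilizer {n m : ℕ} {ξ : Set (F n m)} (h1 : 1 ∈ ξ)
    {g : F n m} (hg : g ∈ translationStabilizer ξ) : g⁻¹ ∈ ξ := by
  rw [mem_translationStabilizer] at hg
  rw [← hg] at h1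
  obtain ⟨h, hh, e⟩ := h1
  rwa [inv_eq_of_mul_eq_one_right e]

theorem mul_inv_mem_translationStabilizer {n m : ℕ} {ξ : Set (F n m)} {g h : F n m}
    (e : transS g⁻¹ ξ = transS h⁻¹ ξ) : h * g⁻¹ ∈ translationStabilizer ξ := by
  rw [mem_translationStabilizer, transS_mul, e, ← transS_mul, mul_inv_cancel, transS_one]

/-- The exponent sum of the generator `a_i`. -/
def exponentSumA {n m : ℕ} (i : Fin n) : F n m →* Multiplicative ℤ :=
  FreeGroup.lift (Sum.elim (fun k => Multiplicative.ofAdd (if k = i then 1 else 0)) fun _ => 1)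

theorem exponentSumA_a {n m : ℕ} (i k : Fin n) :
    exponentSumA i (a k : F n m) = Multiplicative.ofAdd (if k = i then 1 else 0) := by
  simp [exponentSumA, a]

theorem exponentSumA_b {n m : ℕ} (i : Fin n) (j : Fin m) :
    exponentSumA i (b j : F n m) = 1 := by
  simp [exponentSumA, b]

theorem exists_patternC2S {n m : ℕ} {ξ : Set (F n m)} (hξ : ξ ∈ OmegaS n m) :
    ∃ g ∈ ξ, PatternC2S ξ g := by
  obtain ⟨h1, -, hpat⟩ := hξ
  rcases hpat 1 h1 with h | h
  · obtain ⟨i, hi, -⟩ := h.1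
    refine ⟨_, hi, (hpat _ hi).resolve_left fun h' => h'.2.2.1 i ?_⟩
    simpa using h1
  · exact ⟨1, h1, h⟩

theorem PatternC2S.exists_step {n m : ℕ} {ξ : Set (F n m)} (hξ : ξ ∈ OmegaS n m)
    {g : F n m} (hg : g ∈ ξ) (hc : PatternC2S ξ g) (i : Fin n) :
    ∃ j : Fin m, g * (a i)⁻¹ * b j ∈ ξ ∧ PatternC2S ξ (g * (a i)⁻¹ * b j) := by
  obtain ⟨-, -, hpat⟩ := hξ
  have hi := hc.2.2.1 i
  obtain ⟨j, hj, -⟩ := ((hpat _ hi).resolve_right fun h => h.1 i (by simpa using hg)).2.1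
  refine ⟨j, hj, (hpat _ hj).resolve_left fun h => h.2.2.2 j ?_⟩
  simpa using hi

/-- Along a ray in direction `a_i⁻¹` two vertices have the same translate of `ξ`; the resulting
stabilizing element has nonzero exponent sum only in `a_i`. -/
theorem exists_mem_translationStabilizer {n m : ℕ} {Z : Set (Set (F n m))} (hZfin : Z.Finite)
    (hinv : ∀ g : F n m, ∀ ξ ∈ Z, g⁻¹ ∈ ξ → transS g ξ ∈ Z)
    {ξ : Set (F n m)} (hξZ : ξ ∈ Z) (hξ : ξ ∈ OmegaS n m) (i : Fin n) :
    ∃ g ∈ translationStabilizer ξ, exponentSumA i g ≠ 1 ∧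
      ∀ k ≠ i, exponentSumA k g = 1 := by
  obtain ⟨g₀, hg₀, hc₀⟩ := exists_patternC2S hξ
  have : Nonempty (Fin m) := (hc₀.exists_step hξ hg₀ i).nonempty
  choose! j hj hcj using fun (g : F n m) (h : g ∈ ξ ∧ PatternC2S ξ g) =>
    PatternC2S.exists_step hξ h.1 h.2 i
  let r : ℕ → F n m := fun k => (fun g => g * (a i)⁻¹ * b (j g))^[k] g₀
  have r_succ : ∀ k, r (k + 1) = r k * (a i)⁻¹ * b (j (r k)) := fun k =>
    Function.iterate_succ_apply' _ _ _
  have r_mem : ∀ k, r k ∈ ξ ∧ PatternC2S ξ (r k) := by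
    intro k
    induction k with
    | zero => exact ⟨hg₀, hc₀⟩
    | succ k ih => rw [r_succ]; exact ⟨hj _ ih, hcj _ ih⟩
  have r_exp : ∀ l k, exponentSumA l (r k) =
      exponentSumA l g₀ * Multiplicative.ofAdd (if i = l then -(k : ℤ) else 0) := by
    intro l k
    induction k with
    | zero => simp [r]
    | succ k ih =>
      rw [r_succ, map_mul, map_mul, map_inv, ih, exponentSumA_a, exponentSumA_b, mul_one,
        mul_assoc, ← ofAdd_neg, ← ofAdd_add]
      congr 2
      split_ifs <;> push_cast <;> ring
  obtain ⟨p, q, hpq, e⟩ := hZfin.exists_lt_map_eq_of_forall_mem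
    (f := fun k => transS (r k)⁻¹ ξ)
    fun k => hinv _ _ hξZ (by simpa using (r_mem k).1)
  refine ⟨_, mul_inv_mem_translationStabilizer e, ?_, fun k hk => ?_⟩
  · rw [map_mul, map_inv, r_exp, r_exp, Ne, mul_inv_eq_one, mul_right_inj]
    simp only [if_true, EmbeddingLike.apply_eq_iff_eq]
    omega
  · rw [map_mul, map_inv, r_exp, r_exp, if_neg hk.symm, if_neg hk.symm, mul_inv_cancel]

/-- A free group that is not cyclic contains a free group of rank two. -/
theorem IsFreeGroup.exists_injective_of_not_isCyclic {G : Type*} [Group G] [IsFreeGroup G]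
    (h : ¬ IsCyclic G) : ∃ f : FreeGroup (Fin 2) →* G, Function.Injective f := by
  have hX : Nontrivial (IsFreeGroup.Generators G) := by
    by_contra hX
    rw [not_nontrivial_iff_subsingleton] at hX
    refine h ((IsFreeGroup.mulEquiv G).isCyclic.mp ?_)
    rcases isEmpty_or_nonempty (IsFreeGroup.Generators G) with hE | ⟨⟨x⟩⟩
    · infer_instance
    · have : Unique (IsFreeGroup.Generators G) := uniqueOfSubsingleton x
      infer_instance
  obtain ⟨x, y, hxy⟩ := hX
  have hinj : Function.Injective ![x, y] := by
    intro s t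
    fin_cases s <;> fin_cases t <;> simp [hxy, hxy.symm]
  exact ⟨(IsFreeGroup.mulEquiv G).toMonoidHom.comp (FreeGroup.map ![x, y]),
    (IsFreeGroup.mulEquiv G).injective.comp (FreeGroup.map_injective hinj)⟩

theorem not_isCyclic_of_exponentSumA {n m : ℕ} {H : Subgroup (F n m)} {i k : Fin n} {x y : F n m}
    (hx : x ∈ H) (hy : y ∈ H) (hxi : exponentSumA i x ≠ 1) (hyi : exponentSumA i y = 1)
    (hyk : exponentSumA k y ≠ 1) : ¬ IsCyclic H := by
  rintro ⟨t, ht⟩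
  obtain ⟨p, hp⟩ := ht ⟨x, hx⟩
  obtain ⟨q, hq⟩ := ht ⟨y, hy⟩
  have hp' : (t : F n m) ^ p = x := congrArg Subtype.val hp
  have hq' : (t : F n m) ^ q = y := congrArg Subtype.val hq
  rw [← hp', map_zpow] at hxi
  rw [← hq', map_zpow] at hyi hyk
  have hti : exponentSumA i (t : F n m) ≠ 1 := fun h => hxi (by rw [h, one_zpow])
  have hq0 : q = 0 := by
    have h' := congrArg Multiplicative.toAdd hyi
    rw [toAdd_zpow, toAdd_one, smul_eq_mul, mul_eq_zero] at h'
    exact h'.resolve_right fun h => hti (toAdd_eq_zero.mp h)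
  exact hyk (by rw [hq0, zpow_zero])

/-- assume `m, n ≥ 2` and let `Z ⊆ Ω^u` be a finite subset
invariant under the partial action `θ^u`.  Then for every `ξ ∈ Z` the isotropy
set `F^ξ = {g : g⁻¹ ∈ ξ and gξ = ξ}` is a subgroup of `F`, and it contains a
subgroup isomorphic to the free group on two generators. -/
theorem stmt_15 (n m : ℕ) (hm : 2 ≤ m) (hn : 2 ≤ n)
    (Z : Set (Set (F n m))) (hZfin : Z.Finite) (hZΩ : Z ⊆ OmegaS n m)
    (hinv : ∀ g : F n m, ∀ ξ ∈ Z, g⁻¹ ∈ ξ → transS g ξ ∈ Z) :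
    ∀ ξ ∈ Z,
      (∃ H : Subgroup (F n m),
        (H : Set (F n m)) = {g : F n m | g⁻¹ ∈ ξ ∧ transS g ξ = ξ}) ∧
      (∃ K : Subgroup (F n m),
        (K : Set (F n m)) ⊆ {g : F n m | g⁻¹ ∈ ξ ∧ transS g ξ = ξ} ∧
        Nonempty (K ≃* FreeGroup (Fin 2))) := by
  intro ξ hξZ
  have hξ := hZΩ hξZ
  have hset : (translationStabilizer ξ : Set (F n m)) =
      {g : F n m | g⁻¹ ∈ ξ ∧ transS g ξ = ξ} :=
    Set.ext fun g => ⟨fun hg => ⟨inv_mem_of_mem_translationStabilizer hξ.1 hg, hg⟩, And.right⟩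
  refine ⟨⟨_, hset⟩, ?_⟩
  let i₀ : Fin n := ⟨0, by omega⟩
  let i₁ : Fin n := ⟨1, by omega⟩
  have hi : i₀ ≠ i₁ := by simp [i₀, i₁]
  obtain ⟨x, hx, hx₀, -⟩ := exists_mem_translationStabilizer hZfin hinv hξZ hξ i₀
  obtain ⟨y, hy, hy₁, hy'⟩ := exists_mem_translationStabilizer hZfin hinv hξZ hξ i₁
  obtain ⟨f, hf⟩ := IsFreeGroup.exists_injective_of_not_isCyclic
    (not_isCyclic_of_exponentSumA hx hy hx₀ (hy' _ hi) hy₁)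
  let φ := (translationStabilizer ξ).subtype.comp f
  have hφ : Function.Injective φ := Subtype.val_injective.comp hf
  refine ⟨φ.range, ?_, ⟨(MonoidHom.ofInjective hφ).symm⟩⟩
  rw [← hset]
  rintro _ ⟨w, rfl⟩
  exact (f w).2
end

section
/- Let n, m, d be positive integers with n ≠ m. Then there do not exist complex d×d matrices s_1,…,s_n, t_1,…,t_m, v, w satisfying the following relations (R): sᵢ*sᵢ = w for all i and tⱼ*tⱼ = w for all j; Σᵢ sᵢsᵢ* = v and Σⱼ tⱼtⱼ* = v; v·w = 0; and v + w = 1 (the identity matrix). Consequently, when n ≠ m the Leavitt C*-algebra L_{m,n} (and hence its quotient O_{m,n}) admits no nonzero finite-dimensional representation. -/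
open Matrix

/-- If every `(s i)ᴴ * s i` equals `w`, the trace of `∑ i, s i * (s i)ᴴ` is `card ι` times the
trace of `w`. -/
lemma Matrix.trace_sum_mul_conjTranspose_of_forall_eq {ι k R : Type*} [Fintype ι] [Fintype k]
    [CommSemiring R] [StarRing R] {s : ι → Matrix k k R} {w : Matrix k k R}
    (h : ∀ i, (s i)ᴴ * s i = w) :
    (∑ i, s i * (s i)ᴴ).trace = Fintype.card ι * w.trace := by
  simp [Matrix.trace_sum, Matrix.trace_mul_comm (s _), h]

/-- for positive integers `n ≠ m` and `d > 0`, there are no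
complex `d × d` matrices `s_1,…,s_n, t_1,…,t_m, v, w` satisfying the defining
relations (R) of the Leavitt C*-algebra `L_{m,n}`:
`sᵢ* sᵢ = w = tⱼ* tⱼ`, `Σᵢ sᵢ sᵢ* = v = Σⱼ tⱼ tⱼ*`, `v w = 0` and `v + w = 1`.
Consequently, when `n ≠ m`, `L_{m,n}` (and hence its quotient `O_{m,n}`) admits
no nonzero finite-dimensional representation. -/
theorem stmt_16 (n m d : ℕ) (hn : 0 < n) (hm : 0 < m) (hd : 0 < d) (hnm : n ≠ m) :
    ¬ ∃ (s : Fin n → Matrix (Fin d) (Fin d) ℂ)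
        (t : Fin m → Matrix (Fin d) (Fin d) ℂ)
        (v w : Matrix (Fin d) (Fin d) ℂ),
      (∀ i, (s i)ᴴ * s i = w) ∧ (∀ j, (t j)ᴴ * t j = w) ∧
      (∑ i, s i * (s i)ᴴ) = v ∧ (∑ j, t j * (t j)ᴴ) = v ∧
      v * w = 0 ∧ v + w = 1 := by
  rintro ⟨s, t, v, w, hs, ht, hsv, htv, -, hvw⟩
  have hsw : v.trace = n * w.trace := by
    simpa [hsv] using trace_sum_mul_conjTranspose_of_forall_eq hs
  have htw : v.trace = m * w.trace := by
    simpa [htv] using trace_sum_mul_conjTranspose_of_forall_eq ht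
  have hw : w.trace = 0 :=
    (mul_eq_mul_right_iff.mp (hsw.symm.trans htw)).resolve_left (by exact_mod_cast hnm)
  have hs_zero (i : Fin n) : s i = 0 := by
    open scoped ComplexOrder in
    exact trace_conjTranspose_mul_self_eq_zero_iff.mp (by rw [hs i, hw])
  have hw_zero : w = 0 := by rw [← hs ⟨0, hn⟩, hs_zero, mul_zero]
  have hv_zero : v = 0 := by simp [← hsv, hs_zero]
  have : Nonempty (Fin d) := ⟨⟨0, hd⟩⟩
  rw [hv_zero, hw_zero, add_zero] at hvw
  exact zero_ne_one hvw
end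

section
/- Let ξ ∈ X^u (i.e., ξ ∈ Ω^u does not have pattern (c2) at 1). Then ξ has pattern (c1) at 1: there is exactly one i with a_i ∈ ξ and exactly one j with b_j ∈ ξ. Moreover, for this i the translate a_i⁻¹ξ belongs to Y^u, and for this j the translate b_j⁻¹ξ belongs to Y^u. -/
theorem mem_transS {n m : ℕ} {g h : F n m} {ξ : Set (F n m)} :
    h ∈ transS g ξ ↔ g⁻¹ * h ∈ ξ := by
  simp [transS]

theorem IsConvexCfgS.transS {n m : ℕ} {ξ : Set (F n m)} (hξ : IsConvexCfgS ξ) (g : F n m) :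
    IsConvexCfgS (transS g ξ) := by
  intro x hx y hy k hk
  rw [mem_transS] at hx hy ⊢
  refine hξ _ hx _ hy _ ?_
  simpa [mul_assoc] using hk

theorem patternC1S_transS {n m : ℕ} {ξ : Set (F n m)} {g h : F n m} :
    PatternC1S (transS g ξ) h ↔ PatternC1S ξ (g⁻¹ * h) := by
  simp only [PatternC1S, mem_transS, mul_assoc]

theorem patternC2S_transS {n m : ℕ} {ξ : Set (F n m)} {g h : F n m} :
    PatternC2S (transS g ξ) h ↔ PatternC2S ξ (g⁻¹ * h) := by
  simp only [PatternC2S, mem_transS, mul_assoc]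

theorem transS_inv_mem_OmegaS {n m : ℕ} {ξ : Set (F n m)} (hξ : ξ ∈ OmegaS n m) {g : F n m}
    (hg : g ∈ ξ) : transS g⁻¹ ξ ∈ OmegaS n m := by
  refine ⟨by simpa [mem_transS] using hg, hξ.2.1.transS _, fun h hh => ?_⟩
  rw [patternC1S_transS, patternC2S_transS]
  exact hξ.2.2 _ (mem_transS.1 hh)

theorem transS_inv_mem_YuS {n m : ℕ} {ξ : Set (F n m)} (hξ : ξ ∈ OmegaS n m) {g : F n m}
    (hg : g ∈ ξ) (hC1 : ¬ PatternC1S ξ g) : transS g⁻¹ ξ ∈ YuS n m := by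
  have hC2 := (hξ.2.2 g hg).resolve_left hC1
  refine ⟨transS_inv_mem_OmegaS hξ hg, fun i => ?_, fun j => ?_⟩
  · simpa [mem_transS] using hC2.2.2.1 i
  · simpa [mem_transS] using hC2.2.2.2 j

/-- if `ξ ∈ X^u` (that is, `ξ ∈ Ω^u` does not have pattern (c2)
at `1`), then `ξ` has pattern (c1) at `1`; moreover for the (unique) `i` with
`a_i ∈ ξ` the translate `a_i⁻¹ ξ` belongs to `Y^u`, and for the (unique) `j`
with `b_j ∈ ξ` the translate `b_j⁻¹ ξ` belongs to `Y^u`. -/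
theorem stmt_17 (n m : ℕ) (hn : 0 < n) (hm : 0 < m)
    (ξ : Set (F n m)) (hξ : ξ ∈ OmegaS n m) (hξY : ξ ∉ YuS n m) :
    PatternC1S ξ 1 ∧
    (∀ i : Fin n, a i ∈ ξ → transS (a i)⁻¹ ξ ∈ YuS n m) ∧
    (∀ j : Fin m, b j ∈ ξ → transS (b j)⁻¹ ξ ∈ YuS n m) := by
  refine ⟨(hξ.2.2 1 hξ.1).resolve_right fun h => hξY ⟨hξ, ?_, ?_⟩, fun i hi => ?_, fun j hj => ?_⟩
  · simpa using h.2.2.1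
  · simpa using h.2.2.2
  · exact transS_inv_mem_YuS hξ hi fun h => h.2.2.1 i (by simpa using hξ.1)
  · exact transS_inv_mem_YuS hξ hj fun h => h.2.2.2 j (by simpa using hξ.1)
end
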